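/- Let ρ ∈ 𝕊^m(ℝⁿ;𝒜_θ), m ∈ ℝ. Then P_ρ(U^k) = ρ(k) U^k for every k ∈ ℤⁿ, and for every u ∈ 𝒜_θ with Fourier series u = Σ_{k∈ℤⁿ} u_k U^k (u_k = τ(u (U^k)*)) one has P_ρ u = Σ_{k∈ℤⁿ} u_k ρ(k) U^k, the series converging in 𝒜_θ. -/

import Mathlib

open Complex Filter Topology
open scoped ComplexOrder Real BigOperators

noncomputable section

/-- Euclidean space `ℝⁿ`. -/
abbrev Rn (n : ℕ) : Type := EuclideanSpace ℝ (Fin n)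

/-- `ℝⁿ × ℝⁿ`. -/
abbrev R2n (n : ℕ) : Type := Rn n × Rn n

/-- Length `|β|` of a multi-order `β ∈ ℕ₀ⁿ`. -/
def mdeg {n : ℕ} (b : Fin n → ℕ) : ℕ := ∑ j, b j

/-- Composition of a list of self-maps. -/
def compList {X : Type*} (l : List (X → X)) : X → X := l.foldr (· ∘ ·) id

/-- The phase `c(k,l) = Σ_{q<p} k_p θ_{pq} l_q`. -/
def cPhase {n : ℕ} (θ : Matrix (Fin n) (Fin n) ℝ) (k l : Fin n → ℤ) : ℝ :=
  ∑ p, ∑ q, if q < p then (k p : ℝ) * θ p q * (l q : ℝ) else 0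

/-- Euclidean norm `|k|` of a lattice point `k ∈ ℤⁿ`. -/
def znorm {n : ℕ} (k : Fin n → ℤ) : ℝ := Real.sqrt (∑ j, ((k j : ℝ)) ^ 2)

/-- `k^β = ∏ k_jᵝ`. -/
def kpow {n : ℕ} (b : Fin n → ℕ) (k : Fin n → ℤ) : ℝ := ∏ j, ((k j : ℝ)) ^ (b j)

/-- A lattice point `k ∈ ℤⁿ` viewed as a point of `ℝⁿ`. -/
def zEmb {n : ℕ} (k : Fin n → ℤ) : Rn n := (WithLp.equiv 2 (Fin n → ℝ)).symm (fun j => (k j : ℝ))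

variable {n : ℕ} {A : Type} [NormedRing A] [StarRing A] [CStarRing A]
  [NormedAlgebra ℂ A] [StarModule ℂ A] [CompleteSpace A]

/-- The derivation `δ_j u = (1/i) ∂_{s_j} α_s(u)|_{s=0}`. -/
def δd (αa : Rn n → (A ≃⋆ₐ[ℂ] A)) (j : Fin n) (u : A) : A :=
  (-Complex.I) • fderiv ℝ (fun s : Rn n => αa s u) 0 (EuclideanSpace.single j 1)

/-- `δ^β = δ_1^{β_1} ⋯ δ_n^{β_n}`. -/
def δpow (αa : Rn n → (A ≃⋆ₐ[ℂ] A)) (b : Fin n → ℕ) : A → A :=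
  compList (List.ofFn fun j => (δd αa j)^[b j])

/-- The smooth noncommutative torus `𝒜_θ`: elements with `C^∞` orbit map. -/
def SmoothSet (αa : Rn n → (A ≃⋆ₐ[ℂ] A)) : Set A :=
  {u | ∀ N : ℕ, ContDiff ℝ N (fun s : Rn n => αa s u)}

/-- `A_θ^{(N)}`: elements with `C^N` orbit map. -/
def CNSet (αa : Rn n → (A ≃⋆ₐ[ℂ] A)) (N : ℕ) : Set A :=
  {u | ContDiff ℝ N (fun s : Rn n => αa s u)}

/-- The Fréchet seminorms `‖u‖_{(N)} = sup_{|β| ≤ N} ‖δ^β(u)‖` of `𝒜_θ`. -/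
def frSemi (αa : Rn n → (A ≃⋆ₐ[ℂ] A)) (N : ℕ) (u : A) : ℝ :=
  ⨆ b : {b : Fin n → ℕ // mdeg b ≤ N}, ‖δpow αa b.1 u‖

/-- Partial derivative `∂_{ξ_j}` of maps `ℝⁿ → A`. -/
def pd {n : ℕ} (j : Fin n) (f : Rn n → A) : Rn n → A :=
  fun ξ => fderiv ℝ f ξ (EuclideanSpace.single j 1)

/-- Iterated partial derivative `∂_ξ^β` of maps `ℝⁿ → A`. -/
def pdPow {n : ℕ} (b : Fin n → ℕ) : (Rn n → A) → (Rn n → A) :=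
  compList (List.ofFn fun j => (pd j)^[b j])

/-- Partial derivative `∂_{s_j}` (first variable) of maps `ℝⁿ×ℝⁿ → A`. -/
def pdS {n : ℕ} (j : Fin n) (f : R2n n → A) : R2n n → A :=
  fun x => fderiv ℝ f x (EuclideanSpace.single j 1, 0)

/-- Partial derivative `∂_{ξ_j}` (second variable) of maps `ℝⁿ×ℝⁿ → A`. -/
def pdXi {n : ℕ} (j : Fin n) (f : R2n n → A) : R2n n → A :=
  fun x => fderiv ℝ f x (0, EuclideanSpace.single j 1)

/-- `∂_s^β`. -/
def pdSPow {n : ℕ} (b : Fin n → ℕ) : (R2n n → A) → (R2n n → A) :=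
  compList (List.ofFn fun j => (pdS j)^[b j])

/-- `∂_ξ^γ`. -/
def pdXiPow {n : ℕ} (b : Fin n → ℕ) : (R2n n → A) → (R2n n → A) :=
  compList (List.ofFn fun j => (pdXi j)^[b j])

/-- Forward difference operator `Δ_j` on maps `ℝⁿ → A`. -/
def fdiff {n : ℕ} (j : Fin n) (f : Rn n → A) : Rn n → A :=
  fun ξ => f (ξ + EuclideanSpace.single j 1) - f ξ

/-- `Δ^β` on maps `ℝⁿ → A`. -/
def fdiffPow {n : ℕ} (b : Fin n → ℕ) : (Rn n → A) → (Rn n → A) :=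
  compList (List.ofFn fun j => (fdiff j)^[b j])

/-- Forward difference operator `Δ_j` on sequences `ℤⁿ → A`. -/
def zdiff {n : ℕ} (j : Fin n) (f : (Fin n → ℤ) → A) : (Fin n → ℤ) → A :=
  fun k => f (k + Pi.single j 1) - f k

/-- `Δ^β` on sequences `ℤⁿ → A`. -/
def zdiffPow {n : ℕ} (b : Fin n → ℕ) : ((Fin n → ℤ) → A) → ((Fin n → ℤ) → A) :=
  compList (List.ofFn fun j => (zdiff j)^[b j])

/-- The symbol class `𝕊^m(ℝⁿ; 𝒜_θ)`. -/
def IsSymbol (αa : Rn n → (A ≃⋆ₐ[ℂ] A)) (m : ℝ) (ρ : Rn n → A) : Prop :=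
  (∀ ξ, ρ ξ ∈ SmoothSet αa) ∧
  (∀ a : Fin n → ℕ, ∀ N : ℕ, ContDiff ℝ N fun ξ => δpow αa a (ρ ξ)) ∧
  (∀ a b : Fin n → ℕ, ∃ C > 0, ∀ ξ,
    ‖δpow αa a (pdPow b ρ ξ)‖ ≤ C * (1 + ‖ξ‖) ^ (m - (mdeg b : ℝ)))

/-- The class `𝒮(ℝⁿ; 𝒜_θ) = ∩ₘ 𝕊^m(ℝⁿ; 𝒜_θ)`. -/
def IsSchwartzSym (αa : Rn n → (A ≃⋆ₐ[ℂ] A)) (ρ : Rn n → A) : Prop :=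
  ∀ m : ℝ, IsSymbol αa m ρ

/-- The seminorm `p_N^{(m)}` on `𝕊^m(ℝⁿ; 𝒜_θ)`. -/
def pSemi (αa : Rn n → (A ≃⋆ₐ[ℂ] A)) (m : ℝ) (N : ℕ) (ρ : Rn n → A) : ℝ :=
  ⨆ q : {ab : (Fin n → ℕ) × (Fin n → ℕ) // mdeg ab.1 + mdeg ab.2 ≤ N} × Rn n,
    (1 + ‖q.2‖) ^ (-m + (mdeg q.1.1.2 : ℝ)) * ‖δpow αa q.1.1.1 (pdPow q.1.1.2 ρ q.2)‖

/-- The amplitude class `A^m(ℝⁿ×ℝⁿ; 𝒜_θ)`. -/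
def IsAmplitude (αa : Rn n → (A ≃⋆ₐ[ℂ] A)) (m : ℝ) (a : R2n n → A) : Prop :=
  (∀ x, a x ∈ SmoothSet αa) ∧
  (∀ c : Fin n → ℕ, ∀ N : ℕ, ContDiff ℝ N fun x => δpow αa c (a x)) ∧
  (∀ c b g : Fin n → ℕ, ∃ C > 0, ∀ x : R2n n,
    ‖δpow αa c (pdSPow b (pdXiPow g a) x)‖ ≤ C * (1 + ‖x.1‖ + ‖x.2‖) ^ m)

/-- The seminorm `q_N^{(m)}` on `A^m(ℝⁿ×ℝⁿ; 𝒜_θ)`. -/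
def qSemi (αa : Rn n → (A ≃⋆ₐ[ℂ] A)) (m : ℝ) (N : ℕ) (a : R2n n → A) : ℝ :=
  ⨆ q : {t : (Fin n → ℕ) × (Fin n → ℕ) × (Fin n → ℕ) //
      mdeg t.1 + mdeg t.2.1 + mdeg t.2.2 ≤ N} × R2n n,
    (1 + ‖q.2.1‖ + ‖q.2.2‖) ^ (-m) *
      ‖δpow αa q.1.1.1 (pdSPow q.1.1.2.1 (pdXiPow q.1.1.2.2 a) q.2)‖

/-- The toroidal symbol class `𝕊^m(ℤⁿ; 𝒜_θ)`. -/
def IsToroidal (αa : Rn n → (A ≃⋆ₐ[ℂ] A)) (m : ℝ) (ρ : (Fin n → ℤ) → A) : Prop :=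
  (∀ k, ρ k ∈ SmoothSet αa) ∧
  (∀ a b : Fin n → ℕ, ∃ C > 0, ∀ k,
    ‖δpow αa a (zdiffPow b ρ k)‖ ≤ C * (1 + znorm k) ^ (m - (mdeg b : ℝ)))

/-- The coefficient `(1-χ)/(|s|²+|ξ|²)` of the operator `L`. -/
def Lcoef {n : ℕ} (χc : R2n n → ℝ) (x : R2n n) : ℝ := (1 - χc x) / (‖x.1‖ ^ 2 + ‖x.2‖ ^ 2)

/-- The transpose `L^t` of `L = χ + (1-χ)(|s|²+|ξ|²)^{-1} Σ (ξ_j D_{s_j} + s_j D_{ξ_j})`,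
namely `L^t u = χ u - Σ_j (D_{s_j}((1-χ)(|s|²+|ξ|²)^{-1} ξ_j u) + D_{ξ_j}(… s_j u))`. -/
def Ltrans (χc : R2n n → ℝ) (u : R2n n → A) : R2n n → A := fun x =>
  χc x • u x -
    ∑ j, ((-Complex.I) • pdS j (fun y => (Lcoef χc y * y.2 j) • u y) x +
      (-Complex.I) • pdXi j (fun y => (Lcoef χc y * y.1 j) • u y) x)

/-- The (regularized) oscillating integral `(2π)^{-n} ∬ e^{is·ξ} (L^t)^N[a(s,ξ)] ds dξ`. -/
def Josc (χc : R2n n → ℝ) (N : ℕ) (a : R2n n → A) : A :=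
  ((2 * Real.pi) ^ n)⁻¹ •
    MeasureTheory.integral MeasureTheory.volume
      (fun x : R2n n => Complex.exp (Complex.I * ((∑ j, x.1 j * x.2 j : ℝ) : ℂ)) •
        ((Ltrans χc)^[N] a) x)

/-- A convenient integer `> m + 2n`. -/
def Nfor (n : ℕ) (m : ℝ) : ℕ := ⌈m⌉₊ + 2 * n + 1

set_option linter.unusedSectionVars false

section DerivativeBounds

open scoped ContDiff

/-- A family of smooth maps whose derivatives up to order `K` are bounded, uniformly in the
family, by a constant multiple of the weight `w`. -/
def DerivBounded {ι E F : Type*} [NormedAddCommGroup E] [NormedSpace ℝ E] [NormedAddCommGroup F]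
    [NormedSpace ℝ F] (K : ℕ) (w : ι → E → ℝ) (f : ι → E → F) : Prop :=
  (∀ i, ContDiff ℝ ∞ (f i)) ∧
    ∃ C : ℝ, ∀ i x, ∀ j ≤ K, ‖iteratedFDeriv ℝ j (f i) x‖ ≤ C * w i x

namespace DerivBounded

variable {ι E E' F G H : Type*} [NormedAddCommGroup E] [NormedSpace ℝ E]
  [NormedAddCommGroup E'] [NormedSpace ℝ E'] [NormedAddCommGroup F]
  [NormedSpace ℝ F] [NormedAddCommGroup G] [NormedSpace ℝ G] [NormedAddCommGroup H]
  [NormedSpace ℝ H] {K : ℕ} {w w' : ι → E → ℝ} {f g : ι → E → F}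

theorem mono_order {K' : ℕ} (h : DerivBounded K' w f) (hK : K ≤ K') : DerivBounded K w f :=
  ⟨h.1, h.2.imp fun _ hC i x j hj => hC i x j (hj.trans hK)⟩

theorem mono_weight (h : DerivBounded K w f) {c : ℝ} (hw : ∀ i x, 0 ≤ w i x)
    (hc : ∀ i x, w i x ≤ c * w' i x) : DerivBounded K w' f := by
  obtain ⟨h1, C, hC⟩ := h
  refine ⟨h1, |C| * c, fun i x j hj => (hC i x j hj).trans ?_⟩
  calc C * w i x ≤ |C| * w i x := mul_le_mul_of_nonneg_right (le_abs_self C) (hw i x)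
    _ ≤ |C| * (c * w' i x) := mul_le_mul_of_nonneg_left (hc i x) (abs_nonneg C)
    _ = |C| * c * w' i x := by ring

theorem norm_le (h : DerivBounded K w f) : ∃ C, ∀ i x, ‖f i x‖ ≤ C * w i x := by
  obtain ⟨_, C, hC⟩ := h
  exact ⟨C, fun i x => by simpa using hC i x 0 (Nat.zero_le _)⟩

theorem bilin (B : F →L[ℝ] G →L[ℝ] H) {g : ι → E → G} (hf : DerivBounded K w f)
    (hg : DerivBounded K w' g) :
    DerivBounded K (fun i x => w i x * w' i x) (fun i x => B (f i x) (g i x)) := by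
  obtain ⟨hf, C, hC⟩ := hf
  obtain ⟨hg, D, hD⟩ := hg
  refine ⟨fun i => B.isBoundedBilinearMap.contDiff.comp₂ (hf i) (hg i),
    ‖B‖ * 2 ^ K * (C * D), fun i x j hj => ?_⟩
  refine (B.norm_iteratedFDeriv_le_of_bilinear (hf i) (hg i) x (n := j)
    (by exact_mod_cast le_top)).trans ?_
  have hCw : 0 ≤ C * w i x := (norm_nonneg _).trans (hC i x 0 (Nat.zero_le _))
  have hDw : 0 ≤ D * w' i x := (norm_nonneg _).trans (hD i x 0 (Nat.zero_le _))
  have h1 : ∑ a ∈ Finset.range (j + 1), (j.choose a : ℝ) * ‖iteratedFDeriv ℝ a (f i) x‖ *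
      ‖iteratedFDeriv ℝ (j - a) (g i) x‖ ≤
      ∑ a ∈ Finset.range (j + 1), (j.choose a : ℝ) * ((C * w i x) * (D * w' i x)) := by
    refine Finset.sum_le_sum fun a ha => ?_
    rw [mul_assoc]
    have ha' : a ≤ j := Nat.lt_succ_iff.1 (Finset.mem_range.1 ha)
    gcongr
    · exact hC i x a (ha'.trans hj)
    · exact hD i x _ ((Nat.sub_le _ _).trans hj)
  rw [← Finset.sum_mul, ← Nat.cast_sum, Nat.sum_range_choose] at h1
  calc _ ≤ ‖B‖ * (((2 ^ j : ℕ) : ℝ) * ((C * w i x) * (D * w' i x))) := by gcongr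
    _ ≤ ‖B‖ * ((2 ^ K : ℝ) * ((C * w i x) * (D * w' i x))) := by
        push_cast
        gcongr
        norm_num
    _ = _ := by ring

theorem smul {f : ι → E → ℝ} (hf : DerivBounded K w f) (hg : DerivBounded K w' g) :
    DerivBounded K (fun i x => w i x * w' i x) (fun i x => f i x • g i x) :=
  bilin (ContinuousLinearMap.lsmul ℝ ℝ) hf hg

theorem clm (L : F →L[ℝ] G) (hf : DerivBounded K w f) :
    DerivBounded K w (fun i x => L (f i x)) := by
  obtain ⟨hf, C, hC⟩ := hf
  refine ⟨fun i => L.contDiff.comp (hf i), ‖L‖ * C, fun i x j hj => ?_⟩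
  refine (L.norm_iteratedFDeriv_comp_left (hf i).contDiffAt
    (by exact_mod_cast le_top)).trans ?_
  rw [mul_assoc]
  gcongr
  exact hC i x j hj

theorem add (hf : DerivBounded K w f) (hg : DerivBounded K w g) :
    DerivBounded K w (fun i x => f i x + g i x) := by
  obtain ⟨hf, C, hC⟩ := hf
  obtain ⟨hg, D, hD⟩ := hg
  refine ⟨fun i => (hf i).add (hg i), C + D, fun i x j hj => ?_⟩
  have hj' : (j : ℕ∞ω) ≤ ∞ := by exact_mod_cast le_top
  rw [fun_iteratedFDeriv_add_apply ((hf i).of_le hj').contDiffAt ((hg i).of_le hj').contDiffAt, add_mul]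
  exact (norm_add_le _ _).trans (add_le_add (hC i x j hj) (hD i x j hj))

theorem sum {κ : Type*} (s : Finset κ) {f : κ → ι → E → F}
    (hf : ∀ a ∈ s, DerivBounded K w (f a)) :
    DerivBounded K w (fun i x => ∑ a ∈ s, f a i x) := by
  classical
  induction s using Finset.induction_on with
  | empty =>
    refine ⟨fun i => by simpa using contDiff_const, 0, fun i x j _ => ?_⟩
    simp only [Finset.sum_empty, zero_mul]
    rw [iteratedFDeriv_fun_zero]
    simp
  | insert a s ha ih =>
    simp only [Finset.sum_insert ha]
    exact (hf a (Finset.mem_insert_self _ _)).add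
      (ih fun b hb => hf b (Finset.mem_insert_of_mem hb))

theorem fderiv (hf : DerivBounded (K + 1) w f) :
    DerivBounded K w (fun i x => fderiv ℝ (f i) x) := by
  obtain ⟨hf, C, hC⟩ := hf
  refine ⟨fun i => (hf i).fderiv_right (by simp), C, fun i x j hj => ?_⟩
  rw [norm_iteratedFDeriv_fderiv]
  exact hC i x _ (by omega)

theorem fderiv_apply (hf : DerivBounded (K + 1) w f) (v : E) :
    DerivBounded K w (fun i x => _root_.fderiv ℝ (f i) x v) :=
  hf.fderiv.clm (ContinuousLinearMap.apply ℝ F v)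

theorem of_norm_le (hf : ∀ i, ContDiff ℝ ∞ (f i)) {C : ℝ} (hC : ∀ i x, ‖f i x‖ ≤ C * w i x) :
    DerivBounded 0 w f := by
  refine ⟨hf, C, fun i x j hj => ?_⟩
  obtain rfl : j = 0 := by omega
  simpa using hC i x

theorem of_fderiv (hw : ∀ i x, 0 ≤ w i x) (h0 : DerivBounded 0 w f)
    (h1 : DerivBounded K w (fun i x => _root_.fderiv ℝ (f i) x)) : DerivBounded (K + 1) w f := by
  obtain ⟨hf, C, hC⟩ := h0
  obtain ⟨_, D, hD⟩ := h1
  refine ⟨hf, max C D, fun i x j hj => ?_⟩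
  have hCD : C * w i x ≤ max C D * w i x ∧ D * w i x ≤ max C D * w i x :=
    ⟨mul_le_mul_of_nonneg_right (le_max_left _ _) (hw i x),
      mul_le_mul_of_nonneg_right (le_max_right _ _) (hw i x)⟩
  rcases j with _ | j
  · exact (hC i x 0 le_rfl).trans hCD.1
  · rw [← norm_iteratedFDeriv_fderiv]
    exact (hD i x j (by omega)).trans hCD.2

theorem comp_clm {f : ι → E' → F} {w : ι → E' → ℝ} (hf : DerivBounded K w f) (T : ι → E →L[ℝ] E')
    (hT : ∀ i, ‖T i‖ ≤ 1) : DerivBounded K (fun i x => w i (T i x)) (fun i x => f i (T i x)) := by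
  obtain ⟨hf, C, hC⟩ := hf
  refine ⟨fun i => (hf i).comp (T i).contDiff, C, fun i x j hj => ?_⟩
  have := (T i).iteratedFDeriv_comp_right (hf i) x (i := j) (by exact_mod_cast le_top)
  change ‖iteratedFDeriv ℝ j (f i ∘ T i) x‖ ≤ _
  rw [this]
  refine (ContinuousMultilinearMap.norm_compContinuousLinearMap_le _ _).trans ?_
  refine (mul_le_of_le_one_right (norm_nonneg _) ?_).trans (hC i (T i x) j hj)
  exact Finset.prod_le_one (fun _ _ => norm_nonneg _) fun _ _ => hT i

/-- Smooth compactly supported functions have rapidly decaying derivatives. -/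
theorem of_hasCompactSupport {f : E → F} (hf : ContDiff ℝ ∞ f) (hs : HasCompactSupport f) (K : ℕ)
    (r : ℝ) : DerivBounded K (fun (_ : ι) x => (1 + ‖x‖) ^ r) (fun _ => f) := by
  have hpos : ∀ x : E, 0 < 1 + ‖x‖ := fun x => by positivity
  have h : ∀ j : ℕ, ∃ C, ∀ x, ‖(1 + ‖x‖) ^ (-r) * ‖iteratedFDeriv ℝ j f x‖‖ ≤ C := fun j => by
    have hc : Continuous (fun x => ‖iteratedFDeriv ℝ j f x‖) :=
      ((hf.of_le (mod_cast le_top)).continuous_iteratedFDeriv').norm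
    have hs' : HasCompactSupport (fun x => ‖iteratedFDeriv ℝ j f x‖) := (hs.iteratedFDeriv j).norm
    have hr : Continuous (fun x : E => (1 + ‖x‖) ^ (-r)) :=
      (continuous_const.add continuous_norm).rpow_const fun x => Or.inl (hpos x).ne'
    exact (hr.mul hc).bounded_above_of_compact_support hs'.mul_left
  choose C hC using h
  refine ⟨fun _ => hf, ∑ j ∈ Finset.range (K + 1), |C j|, fun _ x j hj => ?_⟩
  have h1 := hC j x
  rw [norm_mul, norm_norm, Real.norm_of_nonneg (Real.rpow_nonneg (hpos x).le _), Real.rpow_neg (hpos x).le,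
    inv_mul_le_iff₀ (Real.rpow_pos_of_pos (hpos x) _), mul_comm] at h1
  refine h1.trans (mul_le_mul_of_nonneg_right ?_ (Real.rpow_nonneg (hpos x).le _))
  exact (le_abs_self _).trans (Finset.single_le_sum (f := fun j => |C j|)
    (fun _ _ => abs_nonneg _) (Finset.mem_range.2 (by omega)))

theorem inv {f : ι → E → ℝ} (hf : DerivBounded K w f) {c : ℝ} (hc : 0 < c)
    (hw : ∀ i x, 0 < w i x) (hfc : ∀ i x, c * w i x ≤ f i x) :
    DerivBounded K (fun i x => (w i x)⁻¹) (fun i x => (f i x)⁻¹) := by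
  have hpos : ∀ i x, 0 < f i x := fun i x => (mul_pos hc (hw i x)).trans_le (hfc i x)
  have h0 : DerivBounded 0 (fun i x => (w i x)⁻¹) (fun i x => (f i x)⁻¹) := by
    refine of_norm_le (C := c⁻¹) (fun i => (hf.1 i).inv fun x => (hpos i x).ne') fun i x => ?_
    rw [Real.norm_of_nonneg (inv_nonneg.2 (hpos i x).le), ← mul_inv]
    exact inv_anti₀ (mul_pos hc (hw i x)) (hfc i x)
  induction K with
  | zero => exact h0
  | succ K ih =>
    refine of_fderiv (fun i x => (inv_pos.2 (hw i x)).le) h0 ?_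
    have ih' := ih (hf.mono_order (Nat.le_succ K))
    have h2 := (ih'.smul ih').bilin (ContinuousLinearMap.lsmul ℝ ℝ) (hf.fderiv.clm
      (-ContinuousLinearMap.id ℝ (E →L[ℝ] ℝ)))
    have h3 : (fun i x => _root_.fderiv ℝ (fun x => (f i x)⁻¹) x) = fun i x =>
        ContinuousLinearMap.lsmul ℝ ℝ ((f i x)⁻¹ • (f i x)⁻¹)
          ((-ContinuousLinearMap.id ℝ (E →L[ℝ] ℝ)) (_root_.fderiv ℝ (f i) x)) := by
      funext i x
      have hd : DifferentiableAt ℝ (f i) x := ((hf.1 i).differentiable (by simp)) x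
      have := (hasDerivAt_inv (hpos i x).ne').comp_hasFDerivAt x hd.hasFDerivAt
      rw [show (fun x => (f i x)⁻¹) = Inv.inv ∘ f i from rfl, this.fderiv]
      ext v
      simp [pow_two]
    rw [h3]
    refine h2.mono_weight (c := 1) (fun i x => ?_) fun i x => ?_
    · have := hw i x
      positivity
    · have := (hw i x).ne'
      field_simp
      exact le_rfl

theorem const (c : F) : DerivBounded K (fun (_ : ι) (_ : E) => (1 : ℝ)) (fun _ _ => c) := by
  refine ⟨fun _ => contDiff_const, ‖c‖, fun _ x j _ => ?_⟩
  rcases j with _ | j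
  · simp
  · rw [iteratedFDeriv_const_of_ne (Nat.succ_ne_zero j)]
    simp

theorem linear (L : E →L[ℝ] F) :
    DerivBounded K (fun (_ : ι) (x : E) => (1 + ‖x‖) ^ (1 : ℝ)) (fun _ x => L x) := by
  have h0 : DerivBounded 0 (fun (_ : ι) (x : E) => (1 + ‖x‖) ^ (1 : ℝ)) (fun _ x => L x) := by
    refine of_norm_le (C := ‖L‖) (fun _ => L.contDiff) fun _ x => ?_
    rw [Real.rpow_one]
    exact (L.le_opNorm x).trans (by gcongr; linarith)
  rcases K with _ | K
  · exact h0
  · refine of_fderiv (fun _ x => by positivity) h0 ?_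
    simp only [ContinuousLinearMap.fderiv]
    refine (const L).mono_weight (c := 1) (by simp) fun _ x => ?_
    simp

theorem bilin_rpow (B : F →L[ℝ] G →L[ℝ] H) {g : ι → E → G} {r s : ℝ}
    (hf : DerivBounded K (fun _ x => (1 + ‖x‖) ^ r) f)
    (hg : DerivBounded K (fun _ x => (1 + ‖x‖) ^ s) g) :
    DerivBounded K (fun _ x => (1 + ‖x‖) ^ (r + s)) (fun i x => B (f i x) (g i x)) := by
  refine (hf.bilin B hg).mono_weight (c := 1) (fun _ x => by positivity) fun _ x => ?_
  rw [one_mul, Real.rpow_add (by positivity)]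

theorem mono_rpow {r s : ℝ} (hf : DerivBounded K (fun _ x => (1 + ‖x‖) ^ r) f) (h : r ≤ s) :
    DerivBounded K (fun _ x => (1 + ‖x‖) ^ s) f := by
  refine hf.mono_weight (c := 1) (fun _ x => by positivity) fun _ x => ?_
  rw [one_mul]
  exact Real.rpow_le_rpow_of_exponent_le (by linarith [norm_nonneg x]) h

theorem sub (hf : DerivBounded K w f) (hg : DerivBounded K w g) :
    DerivBounded K w (fun i x => f i x - g i x) := by
  simpa [sub_eq_add_neg] using hf.add (hg.clm (-ContinuousLinearMap.id ℝ F))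

end DerivBounded

end DerivativeBounds

section CommutingOperators

variable {X : Type*} {D : Fin n → X → X} {S : Set X}

theorem compList_map_mem (hS : ∀ j, ∀ x ∈ S, D j x ∈ S) (b : Fin n → ℕ) (L : List (Fin n))
    {x : X} (hx : x ∈ S) : compList (L.map fun j => (D j)^[b j]) x ∈ S := by
  induction L with
  | nil => exact hx
  | cons j L ih => exact Set.MapsTo.iterate (fun y hy => hS j y hy) (b j) ih

theorem apply_compList_map (hS : ∀ j, ∀ x ∈ S, D j x ∈ S)
    (hD : ∀ i j, ∀ x ∈ S, D i (D j x) = D j (D i x)) (b : Fin n → ℕ) {L : List (Fin n)}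
    (hL : L.Nodup) {i : Fin n} (hi : i ∈ L) {x : X} (hx : x ∈ S) :
    D i (compList (L.map fun j => (D j)^[b j]) x) =
      compList (L.map fun j => (D j)^[Function.update b i (b i + 1) j]) x := by
  have iter_comm : ∀ j k, ∀ y ∈ S, D i ((D j)^[k] y) = (D j)^[k] (D i y) := by
    intro j k
    induction k with
    | zero => exact fun _ _ => rfl
    | succ k ih =>
      intro y hy
      rw [Function.iterate_succ_apply, Function.iterate_succ_apply, ih _ (hS j y hy), hD i j y hy]
  induction L with
  | nil => simp at hi
  | cons j L ih =>
    change D i ((D j)^[b j] (compList (L.map fun j => (D j)^[b j]) x)) =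
      (D j)^[Function.update b i (b i + 1) j] (compList (L.map _) x)
    have hy := compList_map_mem hS b L hx
    rw [List.nodup_cons] at hL
    by_cases hij : i = j
    · subst hij
      have : (L.map fun j => (D j)^[Function.update b i (b i + 1) j]) =
          L.map fun j => (D j)^[b j] := List.map_congr_left fun j hj => by
        rw [Function.update_of_ne]
        rintro rfl
        exact hL.1 hj
      rw [this, Function.update_self, Function.iterate_succ_apply']
    · rw [Function.update_of_ne (Ne.symm hij), iter_comm _ _ _ hy,
        ih hL.2 ((List.mem_cons.1 hi).resolve_left hij)]

/-- A word in commuting operators can be rearranged into a monomial. -/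
theorem exists_foldr_eq_compList (hS : ∀ j, ∀ x ∈ S, D j x ∈ S)
    (hD : ∀ i j, ∀ x ∈ S, D i (D j x) = D j (D i x)) (l : List (Fin n)) :
    ∃ b : Fin n → ℕ, ∀ x ∈ S, l.foldr D x = compList (List.ofFn fun j => (D j)^[b j]) x := by
  simp only [List.ofFn_eq_map]
  induction l with
  | nil =>
    refine ⟨0, fun x _ => ?_⟩
    simp only [Pi.zero_apply, Function.iterate_zero, List.foldr_nil]
    induction List.finRange n with
    | nil => rfl
    | cons j L ih => exact ih
  | cons i l ih =>
    obtain ⟨b, hb⟩ := ih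
    refine ⟨Function.update b i (b i + 1), fun x hx => ?_⟩
    rw [List.foldr_cons, hb x hx,
      apply_compList_map hS hD b (List.nodup_finRange n) (List.mem_finRange i) hx]

/-- A monomial in operators is a word. -/
theorem exists_compList_eq_foldr (D : Fin n → X → X) (b : Fin n → ℕ) :
    ∃ l : List (Fin n), ∀ x, compList (List.ofFn fun j => (D j)^[b j]) x = l.foldr D x := by
  simp only [List.ofFn_eq_map]
  induction List.finRange n with
  | nil => exact ⟨[], fun _ => rfl⟩
  | cons j L ih =>
    obtain ⟨l, hl⟩ := ih
    refine ⟨List.replicate (b j) j ++ l, fun x => ?_⟩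
    rw [List.foldr_append, ← hl]
    change (D j)^[b j] (compList (L.map fun j => (D j)^[b j]) x) = _
    generalize compList (L.map fun j => (D j)^[b j]) x = y
    induction b j with
    | zero => rfl
    | succ k ih' => rw [Function.iterate_succ_apply', ih', List.replicate_succ, List.foldr_cons]

end CommutingOperators

section PartialDerivatives

open scoped ContDiff

variable {B : Type} [NormedRing B] [NormedAlgebra ℂ B]

theorem contDiff_pd {f : Rn n → B} (hf : ContDiff ℝ ∞ f) (j : Fin n) : ContDiff ℝ ∞ (pd j f) :=
  (hf.fderiv_right (by simp)).clm_apply contDiff_const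

theorem pd_comm {f : Rn n → B} (hf : ContDiff ℝ ∞ f) (i j : Fin n) :
    pd i (pd j f) = pd j (pd i f) := by
  have key : ∀ (v w : Rn n) (x : Rn n),
      fderiv ℝ (fun y => fderiv ℝ f y v) x w = fderiv ℝ (fderiv ℝ f) x w v := fun v w x => by
    have hd : DifferentiableAt ℝ (fderiv ℝ f) x :=
      ((hf.fderiv_right (m := ∞) (by simp)).differentiable (by simp)) x
    rw [fderiv_clm_apply hd (differentiableAt_const v)]
    simp
  funext x
  change fderiv ℝ (fun y => fderiv ℝ f y _) x _ = fderiv ℝ (fun y => fderiv ℝ f y _) x _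
  rw [key, key]
  exact (hf.contDiffAt.isSymmSndFDerivAt
    (by simpa using (mod_cast le_top : ((2 : ℕ∞) : ℕ∞ω) ≤ ∞))) _ _

theorem exists_foldr_pd_eq_pdPow (l : List (Fin n)) :
    ∃ b : Fin n → ℕ, ∀ f : Rn n → B, ContDiff ℝ ∞ f → l.foldr pd f = pdPow b f :=
  exists_foldr_eq_compList (S := {f : Rn n → B | ContDiff ℝ ∞ f})
    (fun j _ hf => contDiff_pd hf j) (fun i j _ hf => pd_comm hf i j) l

theorem fderiv_eq_sum_pd (f : Rn n → B) (x : Rn n) :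
    fderiv ℝ f x = ∑ j, ContinuousLinearMap.smulRightL ℝ (Rn n) B
      (EuclideanSpace.proj j : Rn n →L[ℝ] ℝ) (pd j f x) := by
  ext v
  have hv : v = ∑ j, v j • (EuclideanSpace.single j (1 : ℝ) : Rn n) := by
    ext i
    simp [Finset.sum_apply, Pi.single_apply]
  conv_lhs => rw [hv]
  simp only [map_sum, map_smul, sum_apply]
  rfl

theorem DerivBounded.of_pd {ι : Type*} {w : ι → Rn n → ℝ} (hw : ∀ i x, 0 ≤ w i x)
    {f : ι → Rn n → B} (hf : ∀ i, ContDiff ℝ ∞ (f i))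
    (h : ∀ l : List (Fin n), ∃ C, ∀ i x, ‖l.foldr pd (f i) x‖ ≤ C * w i x) (K : ℕ) :
    DerivBounded K w f := by
  induction K generalizing f with
  | zero =>
    obtain ⟨C, hC⟩ := h []
    exact of_norm_le hf hC
  | succ K ih =>
    obtain ⟨C, hC⟩ := h []
    refine of_fderiv hw (of_norm_le hf hC) ?_
    simp only [fderiv_eq_sum_pd]
    refine DerivBounded.sum _ fun j _ => DerivBounded.clm _ (ih (fun i => contDiff_pd (hf i) j) fun l => ?_)
    simpa using h (l ++ [j])

end PartialDerivatives

section PartialDerivatives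

open scoped ContDiff

theorem pd_const_smul {B : Type} [NormedRing B] [NormedAlgebra ℂ B] {f : Rn n → B} (hf : ContDiff ℝ ∞ f) (c : ℂ) (j : Fin n) :
    pd j (fun x => c • f x) = fun x => c • pd j f x := by
  funext x
  change fderiv ℝ (fun x => c • f x) x _ = _
  rw [fderiv_fun_const_smul (hf.differentiable (by simp) x)]
  rfl

end PartialDerivatives


/-- The unitaries `Uk`, the state `τ` and the action `αa` satisfy the defining relations of the
noncommutative torus with parameter `θ`. -/
structure IsNCTorus (θ : Matrix (Fin n) (Fin n) ℝ) (Uk : (Fin n → ℤ) → A) (τ : A →L[ℂ] ℂ)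
    (αa : Rn n → (A ≃⋆ₐ[ℂ] A)) : Prop where
  U_zero : Uk 0 = 1
  U_unitary : ∀ k, Uk k ∈ unitary A
  U_mul : ∀ k l, Uk k * Uk l =
      Complex.exp ((-2 : ℂ) * (Real.pi : ℂ) * Complex.I * (cPhase θ k l : ℂ)) • Uk (k + l)
  dense : Dense (↑(Submodule.span ℂ (Set.range Uk)) : Set A)
  τ_U : ∀ k, τ (Uk k) = if k = 0 then 1 else 0
  act_add : ∀ s t (u : A), αa (s + t) u = αa s (αa t u)
  act_zero : ∀ u : A, αa 0 u = u
  act_norm : ∀ s (u : A), ‖αa s u‖ = ‖u‖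
  act_U : ∀ s k, αa s (Uk k) =
      Complex.exp (Complex.I * ((∑ j, s j * (k j : ℝ) : ℝ) : ℂ)) • Uk k

/-- The coefficient `τ(u (Uᵏ)*)`. -/
def fcoef (Uk : (Fin n → ℤ) → A) (τ : A →L[ℂ] ℂ) (k : Fin n → ℤ) : A →L[ℂ] ℂ :=
  τ.comp ((ContinuousLinearMap.mul ℂ A).flip (star (Uk k)))

/-- The linear form `s ↦ i s·k`. -/
def phaseForm (k : Fin n → ℤ) : Rn n →L[ℝ] ℂ :=
  Complex.I • Complex.ofRealCLM.comp
    (∑ j, (k j : ℝ) • (EuclideanSpace.proj j : Rn n →L[ℝ] ℝ))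

theorem phaseForm_apply (k : Fin n → ℤ) (s : Rn n) :
    phaseForm k s = Complex.I * ((∑ j, s j * (k j : ℝ) : ℝ) : ℂ) := by
  simp [phaseForm, mul_comm]

theorem phaseForm_single (k : Fin n → ℤ) (j : Fin n) :
    phaseForm k (EuclideanSpace.single j 1) = Complex.I * k j := by
  rw [phaseForm_apply]
  simp

namespace IsNCTorus

open scoped ContDiff

variable {θ : Matrix (Fin n) (Fin n) ℝ} {Uk : (Fin n → ℤ) → A} {τ : A →L[ℂ] ℂ}
  {αa : Rn n → (A ≃⋆ₐ[ℂ] A)} (h : IsNCTorus θ Uk τ αa)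

include h

/-- The automorphism `αa s` as a continuous linear map. -/
def act (s : Rn n) : A →L[ℂ] A :=
  LinearMap.mkContinuous
    { toFun := αa s, map_add' := map_add (αa s), map_smul' := map_smul (αa s) } 1
    fun u => by simpa using (h.act_norm s u).le

@[simp] theorem act_apply (s : Rn n) (u : A) : h.act s u = αa s u := rfl

theorem mem_smoothSet {u : A} : u ∈ SmoothSet αa ↔ ContDiff ℝ ∞ (fun s => αa s u) :=
  contDiff_infty.symm

theorem pd_orbit {u : A} (hu : u ∈ SmoothSet αa) (j : Fin n) :
    pd j (fun s => αa s u) = fun t => Complex.I • αa t (δd αa j u) := by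
  have hs : Differentiable ℝ (fun s => αa s u) := (h.mem_smoothSet.1 hu).differentiable (by simp)
  funext t
  have h1 : HasFDerivAt (fun s : Rn n => αa (s - t) u) (fderiv ℝ (fun s => αa s u) 0) t := by
    have h2 : HasFDerivAt (fun s => αa s u) (fderiv ℝ (fun s => αa s u) 0) (t - t) := by
      rw [sub_self]
      exact (hs 0).hasFDerivAt
    exact h2.comp (f := fun s : Rn n => s - t) t ((hasFDerivAt_id t).sub_const t)
  have h3 := (((h.act t).restrictScalars ℝ).hasFDerivAt (x := αa (t - t) u)).comp t h1
  have h4 : (((h.act t).restrictScalars ℝ) ∘ fun s : Rn n => αa (s - t) u) =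
      fun s => αa s u := by
    funext s
    change αa t (αa (s - t) u) = _
    rw [← h.act_add, add_sub_cancel]
  rw [h4] at h3
  change fderiv ℝ (fun s => αa s u) t _ = _
  rw [h3.fderiv]
  change αa t (fderiv ℝ (fun s => αa s u) 0 _) = _
  rw [δd, ← map_smul, smul_smul]
  simp

theorem orbit_δd {u : A} (hu : u ∈ SmoothSet αa) (j : Fin n) :
    (fun s => αa s (δd αa j u)) = fun t => (-Complex.I) • pd j (fun s => αa s u) t := by
  rw [h.pd_orbit hu]
  funext t
  rw [smul_smul]
  simp

theorem δd_mem {u : A} (hu : u ∈ SmoothSet αa) (j : Fin n) : δd αa j u ∈ SmoothSet αa := by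
  rw [h.mem_smoothSet, h.orbit_δd hu]
  exact (contDiff_pd (h.mem_smoothSet.1 hu) j).const_smul (-Complex.I)

theorem δd_comm {u : A} (hu : u ∈ SmoothSet αa) (i j : Fin n) :
    δd αa i (δd αa j u) = δd αa j (δd αa i u) := by
  have key : ∀ i j, δd αa i (δd αa j u) = (-1 : ℂ) • pd i (pd j fun s => αa s u) 0 := fun i j => by
    have h1 := congrFun (h.orbit_δd (h.δd_mem hu j) i) 0
    rw [h.orbit_δd hu, pd_const_smul (contDiff_pd (h.mem_smoothSet.1 hu) j)] at h1
    simp only [h.act_zero, smul_smul] at h1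
    rw [h1]
    simp
  rw [key, key, pd_comm (h.mem_smoothSet.1 hu)]

theorem foldr_δd_mem {u : A} (hu : u ∈ SmoothSet αa) (l : List (Fin n)) :
    l.foldr (δd αa) u ∈ SmoothSet αa := by
  induction l with
  | nil => exact hu
  | cons j l ih => exact h.δd_mem ih j

theorem foldr_pd_orbit {u : A} (hu : u ∈ SmoothSet αa) (l : List (Fin n)) :
    l.foldr pd (fun s => αa s u) = fun t => Complex.I ^ l.length • αa t (l.foldr (δd αa) u) := by
  induction l with
  | nil => simp
  | cons j l ih =>
    have hl := h.foldr_δd_mem hu l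
    rw [List.foldr_cons, ih, pd_const_smul (h.mem_smoothSet.1 hl), h.pd_orbit hl]
    simp only [smul_smul, List.length_cons, List.foldr_cons, pow_succ]

theorem exists_foldr_δd_eq_δpow (l : List (Fin n)) :
    ∃ b : Fin n → ℕ, ∀ u ∈ SmoothSet αa, l.foldr (δd αa) u = δpow αa b u :=
  exists_foldr_eq_compList (fun j _ hf => h.δd_mem hf j) (fun i j _ hf => h.δd_comm hf i j) l

theorem derivBounded_orbit {ι : Type*} {w : ι → ℝ} (hw : ∀ i, 0 ≤ w i) {f : ι → A}
    (hf : ∀ i, f i ∈ SmoothSet αa)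
    (hb : ∀ l : List (Fin n), ∃ C, ∀ i, ‖l.foldr (δd αa) (f i)‖ ≤ C * w i) (K : ℕ) :
    DerivBounded K (fun i (_ : Rn n) => w i) (fun i s => αa s (f i)) := by
  refine DerivBounded.of_pd (fun i _ => hw i) (fun i => h.mem_smoothSet.1 (hf i)) (fun l => ?_) K
  obtain ⟨C, hC⟩ := hb l
  refine ⟨C, fun i x => ?_⟩
  rw [h.foldr_pd_orbit (hf i), norm_smul, norm_pow, Complex.norm_I, one_pow, one_mul, h.act_norm]
  exact hC i

theorem differentiableAt_orbit {u : A} (hu : u ∈ SmoothSet αa) (s : Rn n) :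
    DifferentiableAt ℝ (fun s => αa s u) s :=
  (h.mem_smoothSet.1 hu).differentiable (by simp) s

theorem add_mem {u v : A} (hu : u ∈ SmoothSet αa) (hv : v ∈ SmoothSet αa) :
    u + v ∈ SmoothSet αa := fun N => by
  simpa only [map_add] using (hu N).add (hv N)

theorem smul_mem {u : A} (c : ℂ) (hu : u ∈ SmoothSet αa) : c • u ∈ SmoothSet αa := fun N => by
  simpa only [map_smul] using (hu N).const_smul c

theorem mul_mem {u v : A} (hu : u ∈ SmoothSet αa) (hv : v ∈ SmoothSet αa) :
    u * v ∈ SmoothSet αa := fun N => by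
  simpa only [map_mul] using (hu N).mul (hv N)

theorem δd_add {u v : A} (hu : u ∈ SmoothSet αa) (hv : v ∈ SmoothSet αa) (j : Fin n) :
    δd αa j (u + v) = δd αa j u + δd αa j v := by
  simp only [δd, map_add]
  rw [fderiv_fun_add (h.differentiableAt_orbit hu 0) (h.differentiableAt_orbit hv 0)]
  exact smul_add _ _ _

theorem δd_smul (c : ℂ) {u : A} (hu : u ∈ SmoothSet αa) (j : Fin n) :
    δd αa j (c • u) = c • δd αa j u := by
  simp only [δd, map_smul]
  rw [fderiv_fun_const_smul (h.differentiableAt_orbit hu 0)]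
  exact smul_comm _ _ _

theorem δd_mul {u v : A} (hu : u ∈ SmoothSet αa) (hv : v ∈ SmoothSet αa) (j : Fin n) :
    δd αa j (u * v) = δd αa j u * v + u * δd αa j v := by
  simp only [δd, map_mul]
  rw [fderiv_fun_mul' (h.differentiableAt_orbit hu 0) (h.differentiableAt_orbit hv 0)]
  simp [h.act_zero, add_comm]

theorem foldr_δd_add {u v : A} (hu : u ∈ SmoothSet αa) (hv : v ∈ SmoothSet αa)
    (l : List (Fin n)) :
    l.foldr (δd αa) (u + v) = l.foldr (δd αa) u + l.foldr (δd αa) v := by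
  induction l with
  | nil => rfl
  | cons j l ih =>
    simp only [List.foldr_cons, ih, h.δd_add (h.foldr_δd_mem hu l) (h.foldr_δd_mem hv l)]

theorem foldr_δd_smul (c : ℂ) {u : A} (hu : u ∈ SmoothSet αa) (l : List (Fin n)) :
    l.foldr (δd αa) (c • u) = c • l.foldr (δd αa) u := by
  induction l with
  | nil => rfl
  | cons j l ih => simp only [List.foldr_cons, ih, h.δd_smul c (h.foldr_δd_mem hu l)]

theorem U_mem (k : Fin n → ℤ) : Uk k ∈ SmoothSet αa := by
  rw [h.mem_smoothSet]
  simp only [h.act_U, ← phaseForm_apply]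
  exact (phaseForm k).contDiff.cexp.smul contDiff_const

theorem δd_U (k : Fin n → ℤ) (j : Fin n) : δd αa j (Uk k) = (k j : ℂ) • Uk k := by
  have h1 : HasFDerivAt (fun s : Rn n => Complex.exp (phaseForm k s) • Uk k) _ 0 :=
    ((phaseForm k).hasFDerivAt.cexp).smul_const (Uk k)
  simp only [δd, h.act_U, ← phaseForm_apply]
  rw [h1.fderiv]
  simp [phaseForm_single, smul_smul, ← mul_assoc]

end IsNCTorus

section LatticeWeight

/-- The weight `∏ⱼ (1 + kⱼ²)` on the lattice. -/
def latticeWeight (k : Fin n → ℤ) : ℝ := ∏ j, (1 + (k j : ℝ) ^ 2)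

theorem one_add_sum_le_latticeWeight (k : Fin n → ℤ) :
    1 + ∑ j, (k j : ℝ) ^ 2 ≤ latticeWeight k := by
  unfold latticeWeight
  induction (Finset.univ : Finset (Fin n)) using Finset.induction_on with
  | empty => simp
  | insert j s hj ih =>
    rw [Finset.sum_insert hj, Finset.prod_insert hj]
    have h1 : 0 ≤ ∑ j ∈ s, (k j : ℝ) ^ 2 := Finset.sum_nonneg fun _ _ => sq_nonneg _
    nlinarith [sq_nonneg (k j : ℝ)]

theorem one_le_latticeWeight (k : Fin n → ℤ) : 1 ≤ latticeWeight k :=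
  (le_add_of_nonneg_right (Finset.sum_nonneg fun _ _ => sq_nonneg _)).trans
    (one_add_sum_le_latticeWeight k)

theorem abs_le_latticeWeight (k : Fin n → ℤ) (j : Fin n) : |(k j : ℝ)| ≤ latticeWeight k := by
  have h1 : (k j : ℝ) ^ 2 ≤ ∑ j, (k j : ℝ) ^ 2 :=
    Finset.single_le_sum (f := fun j => (k j : ℝ) ^ 2) (fun _ _ => sq_nonneg _) (Finset.mem_univ j)
  have h2 := one_add_sum_le_latticeWeight k
  rw [← sq_abs] at h1
  nlinarith [sq_nonneg (|(k j : ℝ)| - 1)]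

theorem norm_zEmb_le_latticeWeight (k : Fin n → ℤ) : ‖zEmb k‖ ≤ latticeWeight k := by
  have h1 : ‖zEmb k‖ ^ 2 = ∑ j, (k j : ℝ) ^ 2 := EuclideanSpace.real_norm_sq_eq _
  have h2 := one_add_sum_le_latticeWeight k
  nlinarith [sq_nonneg (‖zEmb k‖ - 1)]

theorem exists_rpow_norm_zEmb_le (m : ℝ) :
    ∃ (C : ℝ) (M : ℕ), ∀ k : Fin n → ℤ, (1 + ‖zEmb k‖) ^ m ≤ C * latticeWeight k ^ M := by
  obtain ⟨M, hM⟩ := exists_nat_ge m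
  refine ⟨2 ^ M, M, fun k => ?_⟩
  rw [← mul_pow]
  calc (1 + ‖zEmb k‖) ^ m ≤ (1 + ‖zEmb k‖) ^ (M : ℝ) :=
        Real.rpow_le_rpow_of_exponent_le (by linarith [norm_nonneg (zEmb k)]) hM
    _ = (1 + ‖zEmb k‖) ^ M := Real.rpow_natCast _ _
    _ ≤ _ := by
      gcongr
      linarith [norm_zEmb_le_latticeWeight k, one_le_latticeWeight k]

theorem summable_inv_latticeWeight :
    ∀ n : ℕ, Summable fun k : Fin n → ℤ => (latticeWeight k)⁻¹
  | 0 => Summable.of_finite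
  | n + 1 => by
    have h1 : Summable fun k : ℤ => (1 + (k : ℝ) ^ 2)⁻¹ := by
      refine .of_norm_bounded_eventually (Real.summable_one_div_int_pow.2 one_lt_two) ?_
      filter_upwards [(Set.finite_singleton (0 : ℤ)).compl_mem_cofinite] with k hk
      have : (k : ℝ) ≠ 0 := by exact_mod_cast hk
      rw [Real.norm_of_nonneg (by positivity), one_div]
      exact inv_anti₀ (by positivity) (by linarith)
    refine ((Fin.consEquiv fun _ => ℤ).summable_iff).1 ?_
    refine (h1.mul_of_nonneg (summable_inv_latticeWeight n)
      (fun _ => by positivity) fun k => inv_nonneg.2 (zero_le_one.trans (one_le_latticeWeight k))).congr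
      fun k => ?_
    simp [latticeWeight, Fin.prod_univ_succ, Fin.consEquiv, mul_comm]

end LatticeWeight

namespace IsNCTorus

open scoped ContDiff

variable {θ : Matrix (Fin n) (Fin n) ℝ} {Uk : (Fin n → ℤ) → A} {τ : A →L[ℂ] ℂ}
  {αa : Rn n → (A ≃⋆ₐ[ℂ] A)} (h : IsNCTorus θ Uk τ αa)

include h

theorem U_mul_star (k : Fin n → ℤ) : Uk k * star (Uk k) = 1 :=
  Unitary.mul_star_self_of_mem (h.U_unitary k)

theorem norm_mul_U (x : A) (k : Fin n → ℤ) : ‖x * Uk k‖ = ‖x‖ :=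
  CStarRing.norm_mul_mem_unitary x (h.U_unitary k)

theorem fcoef_U (k l : Fin n → ℤ) : fcoef Uk τ k (Uk l) = if l = k then 1 else 0 := by
  change τ (Uk l * star (Uk k)) = _
  split_ifs with hlk
  · rw [hlk, h.U_mul_star, ← h.U_zero, h.τ_U, if_pos rfl]
  · obtain ⟨c, hc, h1⟩ : ∃ c : ℂ, c ≠ 0 ∧ Uk k * Uk (-k) = c • (1 : A) :=
      ⟨_, Complex.exp_ne_zero _, by rw [h.U_mul, add_neg_cancel, h.U_zero]⟩
    have h2 : star (Uk k) = c⁻¹ • Uk (-k) := by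
      have h3 : star (Uk k) * (Uk k * Uk (-k)) = Uk (-k) := by
        rw [← mul_assoc, Unitary.star_mul_self_of_mem (h.U_unitary k), one_mul]
      rw [← h3, h1, mul_smul_comm, mul_one, smul_smul, inv_mul_cancel₀ hc, one_smul]
    rw [h2, mul_smul_comm, h.U_mul, map_smul, map_smul, h.τ_U, if_neg, smul_zero, smul_zero]
    rwa [← sub_eq_add_neg, sub_eq_zero]

theorem norm_fcoef_le (k : Fin n → ℤ) (u : A) : ‖fcoef Uk τ k u‖ ≤ ‖τ‖ * ‖u‖ := by
  refine (τ.le_opNorm _).trans_eq ?_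
  change ‖τ‖ * ‖u * star (Uk k)‖ = _
  rw [CStarRing.norm_mul_mem_unitary u (Unitary.star_mem (h.U_unitary k))]

theorem fcoef_act (k : Fin n → ℤ) (s : Rn n) (u : A) :
    fcoef Uk τ k (αa s u) = Complex.exp (phaseForm k s) * fcoef Uk τ k u := by
  have : (fcoef Uk τ k).comp (h.act s) = Complex.exp (phaseForm k s) • fcoef Uk τ k := by
    refine ContinuousLinearMap.ext_on h.dense ?_
    rintro _ ⟨l, rfl⟩
    rw [ContinuousLinearMap.comp_apply, h.act_apply, h.act_U, map_smul, _root_.smul_apply, h.fcoef_U]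
    split_ifs with hl
    · rw [hl, phaseForm_apply]
    · simp
  exact congrArg (fun f : A →L[ℂ] ℂ => f u) this

theorem fcoef_δd (k : Fin n → ℤ) (j : Fin n) {u : A} (hu : u ∈ SmoothSet αa) :
    fcoef Uk τ k (δd αa j u) = (k j : ℂ) * fcoef Uk τ k u := by
  have h1 := (((fcoef Uk τ k).restrictScalars ℝ).hasFDerivAt (x := αa 0 u)).comp 0
    (h.differentiableAt_orbit hu 0).hasFDerivAt
  have h2 : ((fcoef Uk τ k).restrictScalars ℝ) ∘ (fun s => αa s u) =
      fun s => Complex.exp (phaseForm k s) • fcoef Uk τ k u :=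
    funext fun s => h.fcoef_act k s u
  rw [h2] at h1
  have h3 : HasFDerivAt (fun s : Rn n => Complex.exp (phaseForm k s) • fcoef Uk τ k u) _ 0 :=
    ((phaseForm k).hasFDerivAt.cexp).smul_const _
  have h4 := congrArg (fun L : Rn n →L[ℝ] ℂ => L (EuclideanSpace.single j 1)) (h1.unique h3)
  simp only [ContinuousLinearMap.comp_apply, ContinuousLinearMap.coe_restrictScalars',
    ContinuousLinearMap.smulRight_apply, _root_.smul_apply] at h4
  rw [δd, map_smul, h4, phaseForm_single]
  simp [← mul_assoc]

theorem exists_fcoef_eq (u : A) (hu : u ∈ SmoothSet αa) (p : ℕ) :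
    ∃ v ∈ SmoothSet αa, ∀ k, fcoef Uk τ k v = ((latticeWeight k ^ p : ℝ) : ℂ) * fcoef Uk τ k u := by
  have step : ∀ u ∈ SmoothSet αa, ∃ v ∈ SmoothSet αa,
      ∀ k, fcoef Uk τ k v = ((latticeWeight k : ℝ) : ℂ) * fcoef Uk τ k u := by
    intro u hu
    unfold latticeWeight
    induction (Finset.univ : Finset (Fin n)) using Finset.induction_on with
    | empty => exact ⟨u, hu, by simp⟩
    | insert j s hj ih =>
      obtain ⟨v, hv, hvu⟩ := ih
      have hd := h.δd_mem (h.δd_mem hv j) j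
      refine ⟨v + δd αa j (δd αa j v), h.add_mem hv hd, fun k => ?_⟩
      rw [map_add, h.fcoef_δd k j (h.δd_mem hv j), h.fcoef_δd k j hv, hvu, Finset.prod_insert hj]
      push_cast
      ring
  induction p with
  | zero => exact ⟨u, hu, by simp⟩
  | succ p ih =>
    obtain ⟨v, hv, hvu⟩ := ih
    obtain ⟨v', hv', hvv⟩ := step v hv
    refine ⟨v', hv', fun k => ?_⟩
    rw [hvv, hvu]
    push_cast
    ring

/-- The Fourier coefficients of a smooth element decay rapidly. -/
theorem summable_fcoef {u : A} (hu : u ∈ SmoothSet αa) (M : ℕ) :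
    Summable fun k => latticeWeight k ^ M * ‖fcoef Uk τ k u‖ := by
  obtain ⟨v, -, hv⟩ := h.exists_fcoef_eq u hu (M + 1)
  refine .of_nonneg_of_le (fun k => ?_) (fun k => ?_)
    ((summable_inv_latticeWeight n).mul_right (‖τ‖ * ‖v‖))
  · have := one_le_latticeWeight k
    positivity
  · have h1 := h.norm_fcoef_le k v
    have h2 : 0 < latticeWeight k := one_pos.trans_le (one_le_latticeWeight k)
    rw [hv, norm_mul, Complex.norm_real, Real.norm_of_nonneg (by positivity)] at h1
    rw [inv_mul_eq_div, le_div_iff₀ h2]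
    refine le_trans (le_of_eq ?_) h1
    ring

theorem hasFDerivAt_orbit {u : A} (hu : u ∈ SmoothSet αa) (s : Rn n) :
    HasFDerivAt (fun s => αa s u) (∑ j, ContinuousLinearMap.smulRightL ℝ (Rn n) A
      (EuclideanSpace.proj j : Rn n →L[ℝ] ℝ) (Complex.I • αa s (δd αa j u))) s := by
  have h1 := (h.differentiableAt_orbit hu s).hasFDerivAt
  rw [fderiv_eq_sum_pd] at h1
  simpa only [h.pd_orbit hu] using h1

section Series

variable {ι : Type*} {f : ι → A}

theorem hasFDerivAt_orbit_hasSum (hf : ∀ i, f i ∈ SmoothSet αa)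
    (hs : ∀ j, Summable fun i => ‖δd αa j (f i)‖) {a : A} (ha : HasSum f a) (s : Rn n) :
    HasFDerivAt (fun s => αa s a) (∑ j, ContinuousLinearMap.smulRightL ℝ (Rn n) A
      (EuclideanSpace.proj j : Rn n →L[ℝ] ℝ) (Complex.I • αa s (∑' i, δd αa j (f i)))) s := by
  have h0 : ∀ s, HasSum (fun i => αa s (f i)) (αa s a) := fun s => (h.act s).hasSum ha
  have hb : ∀ i s, ‖∑ j, ContinuousLinearMap.smulRightL ℝ (Rn n) A
      (EuclideanSpace.proj j : Rn n →L[ℝ] ℝ) (Complex.I • αa s (δd αa j (f i)))‖ ≤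
      ∑ j, ‖ContinuousLinearMap.smulRightL ℝ (Rn n) A
        (EuclideanSpace.proj j : Rn n →L[ℝ] ℝ)‖ * ‖δd αa j (f i)‖ := fun i s => by
    refine norm_sum_le_of_le _ fun j _ => (ContinuousLinearMap.le_opNorm _ _).trans_eq ?_
    rw [norm_smul, Complex.norm_I, one_mul, h.act_norm]
  have h1 := hasFDerivAt_tsum (summable_sum fun j _ => (hs j).mul_left _)
    (fun i s => h.hasFDerivAt_orbit (hf i) s) hb (h0 0).summable s
  have h2 : (fun s => αa s a) = fun s => ∑' i, αa s (f i) := funext fun s => (h0 s).tsum_eq.symm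
  rw [h2]
  refine h1.congr_fderiv (HasSum.tsum_eq (L := SummationFilter.unconditional ι) (hasSum_sum (f := fun j i => ContinuousLinearMap.smulRightL ℝ (Rn n) A
    (EuclideanSpace.proj j : Rn n →L[ℝ] ℝ) (Complex.I • αa s (δd αa j (f i))))
    fun j _ => ?_))
  refine ContinuousLinearMap.hasSum _ (HasSum.const_smul Complex.I ?_)
  exact (h.act s).hasSum (hs j).of_norm.hasSum

theorem hasSum_foldr_δd (hf : ∀ i, f i ∈ SmoothSet αa)
    (hs : ∀ l : List (Fin n), Summable fun i => ‖l.foldr (δd αa) (f i)‖) {a : A}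
    (ha : HasSum f a) (l : List (Fin n)) :
    HasSum (fun i => l.foldr (δd αa) (f i)) (l.foldr (δd αa) a) := by
  induction l with
  | nil => exact ha
  | cons j l ih =>
    have hd := h.hasFDerivAt_orbit_hasSum (fun i => h.foldr_δd_mem (hf i) l)
      (fun j => hs (j :: l)) ih 0
    have h1 : δd αa j (l.foldr (δd αa) a) = ∑' i, δd αa j (l.foldr (δd αa) (f i)) := by
      rw [δd, hd.fderiv]
      simp [h.act_zero, smul_smul]
    rw [List.foldr_cons, h1]
    exact (hs (j :: l)).of_norm.hasSum

end Series

/-- All derivations of the family have polynomial growth. -/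
def _root_.PolyGrowth (αa : Rn n → (A ≃⋆ₐ[ℂ] A)) (x : (Fin n → ℤ) → A) : Prop :=
  (∀ k, x k ∈ SmoothSet αa) ∧ ∀ l : List (Fin n), ∃ (C : ℝ) (M : ℕ),
    ∀ k, ‖l.foldr (δd αa) (x k)‖ ≤ C * latticeWeight k ^ M

theorem polyGrowth_δd_add {x : (Fin n → ℤ) → A} (hx : PolyGrowth αa x) (j : Fin n) :
    PolyGrowth αa fun k => δd αa j (x k) + (k j : ℂ) • x k := by
  refine ⟨fun k => h.add_mem (h.δd_mem (hx.1 k) j) (h.smul_mem _ (hx.1 k)), fun l => ?_⟩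
  obtain ⟨C, M, hC⟩ := hx.2 (l ++ [j])
  obtain ⟨D, N, hD⟩ := hx.2 l
  refine ⟨|C| + |D|, M + N + 1, fun k => ?_⟩
  have hC' := hC k
  have hD' := hD k
  rw [List.foldr_append] at hC'
  rw [h.foldr_δd_add (h.δd_mem (hx.1 k) j) (h.smul_mem _ (hx.1 k)), h.foldr_δd_smul _ (hx.1 k)]
  refine (norm_add_le _ _).trans ?_
  have h1 := one_le_latticeWeight k
  have h2 : ‖(k j : ℂ)‖ ≤ latticeWeight k := by
    simpa using abs_le_latticeWeight k j
  rw [norm_smul, add_mul]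
  refine add_le_add (hC'.trans ?_) ?_
  · refine mul_le_mul (le_abs_self C) (pow_le_pow_right₀ h1 (by omega)) (by positivity)
      (abs_nonneg C)
  · calc ‖(k j : ℂ)‖ * ‖l.foldr (δd αa) (x k)‖ ≤ latticeWeight k * (|D| * latticeWeight k ^ N) := by
          refine mul_le_mul h2 (hD'.trans ?_) (norm_nonneg _) (by positivity)
          exact mul_le_mul_of_nonneg_right (le_abs_self D) (by positivity)
      _ = |D| * latticeWeight k ^ (N + 1) := by ring
      _ ≤ _ := by
          refine mul_le_mul_of_nonneg_left (pow_le_pow_right₀ h1 (by omega)) (abs_nonneg D)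

theorem polyGrowth_mul_U {x : (Fin n → ℤ) → A} (hx : PolyGrowth αa x) :
    PolyGrowth αa fun k => x k * Uk k := by
  refine ⟨fun k => h.mul_mem (hx.1 k) (h.U_mem k), fun l => ?_⟩
  induction l using List.reverseRecOn generalizing x with
  | nil =>
    obtain ⟨C, M, hC⟩ := hx.2 []
    exact ⟨C, M, fun k => by simpa [h.norm_mul_U] using hC k⟩
  | append_singleton l j ih =>
    obtain ⟨C, M, hC⟩ := ih (h.polyGrowth_δd_add hx j)
    refine ⟨C, M, fun k => ?_⟩
    have h1 : δd αa j (x k * Uk k) = (δd αa j (x k) + (k j : ℂ) • x k) * Uk k := by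
      rw [h.δd_mul (hx.1 k) (h.U_mem k), h.δd_U, add_mul, mul_smul_comm, smul_mul_assoc]
    rw [List.foldr_append]
    simpa only [List.foldr_cons, List.foldr_nil, h1] using hC k

theorem polyGrowth_symbol {m : ℝ} {ρ : Rn n → A} (hρ : IsSymbol αa m ρ) :
    PolyGrowth αa fun k => ρ (zEmb k) := by
  refine ⟨fun k => hρ.1 _, fun l => ?_⟩
  obtain ⟨b, hb⟩ := h.exists_foldr_δd_eq_δpow l
  obtain ⟨C, hC0, hC⟩ := hρ.2.2 b 0
  obtain ⟨D, M, hD⟩ := exists_rpow_norm_zEmb_le (n := n) m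
  refine ⟨C * D, M, fun k => ?_⟩
  have h0 : pdPow 0 ρ = ρ := by
    simp only [pdPow, Pi.zero_apply, Function.iterate_zero, List.ofFn_eq_map]
    induction List.finRange n with
    | nil => rfl
    | cons j L ih => exact ih
  have h1 := hC (zEmb k)
  rw [h0] at h1
  simp only [mdeg, Pi.zero_apply, Finset.sum_const_zero, Nat.cast_zero, sub_zero] at h1
  rw [hb _ (hρ.1 _), mul_assoc]
  exact h1.trans (mul_le_mul_of_nonneg_left (hD k) hC0.le)

theorem summable_foldr_δd_fcoef_smul {x : (Fin n → ℤ) → A} (hx : PolyGrowth αa x) {u : A}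
    (hu : u ∈ SmoothSet αa) (l : List (Fin n)) :
    Summable fun k => ‖l.foldr (δd αa) (fcoef Uk τ k u • (x k))‖ := by
  obtain ⟨C, M, hC⟩ := hx.2 l
  refine .of_nonneg_of_le (fun k => norm_nonneg _) (fun k => ?_)
    ((h.summable_fcoef hu M).mul_left C)
  rw [h.foldr_δd_smul _ (hx.1 k), norm_smul]
  calc _ ≤ ‖fcoef Uk τ k u‖ * (C * latticeWeight k ^ M) :=
        mul_le_mul_of_nonneg_left (hC k) (norm_nonneg _)
    _ = _ := by ring

end IsNCTorus

section TransposedOperator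

open scoped ContDiff

variable {B : Type} [NormedRing B] [NormedAlgebra ℂ B] {ι : Type*} {K : ℕ} {χc : R2n n → ℝ}

theorem derivBounded_coord_fst (j : Fin n) :
    DerivBounded K (fun (_ : ι) (x : R2n n) => (1 + ‖x‖) ^ (1 : ℝ)) (fun _ x => x.1 j) :=
  DerivBounded.linear ((EuclideanSpace.proj j : Rn n →L[ℝ] ℝ).comp
    (ContinuousLinearMap.fst ℝ (Rn n) (Rn n)))

theorem derivBounded_coord_snd (j : Fin n) :
    DerivBounded K (fun (_ : ι) (x : R2n n) => (1 + ‖x‖) ^ (1 : ℝ)) (fun _ x => x.2 j) :=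
  DerivBounded.linear ((EuclideanSpace.proj j : Rn n →L[ℝ] ℝ).comp
    (ContinuousLinearMap.snd ℝ (Rn n) (Rn n)))

theorem derivBounded_sq_norm :
    DerivBounded K (fun (_ : ι) (x : R2n n) => (1 + ‖x‖) ^ (2 : ℝ))
      (fun _ x => ‖x.1‖ ^ 2 + ‖x.2‖ ^ 2) := by
  simp only [EuclideanSpace.real_norm_sq_eq]
  simp only [pow_two]
  refine .add (.sum _ fun j _ => ?_) (.sum _ fun j _ => ?_)
  · exact ((derivBounded_coord_fst j).bilin_rpow (ContinuousLinearMap.mul ℝ ℝ)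
      (derivBounded_coord_fst j)).mono_rpow (by norm_num)
  · exact ((derivBounded_coord_snd j).bilin_rpow (ContinuousLinearMap.mul ℝ ℝ)
      (derivBounded_coord_snd j)).mono_rpow (by norm_num)

theorem derivBounded_Lcoef (hχ : ContDiff ℝ ∞ χc) (hχcp : HasCompactSupport χc)
    (hχ1 : ∀ᶠ x in 𝓝 (0 : R2n n), χc x = 1) :
    DerivBounded K (fun (_ : ι) (x : R2n n) => (1 + ‖x‖) ^ (-2 : ℝ)) (fun _ => Lcoef χc) := by
  obtain ⟨ε, hε, hεχ⟩ := Metric.eventually_nhds_iff_ball.1 hχ1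
  have hδ : 0 < min ε 1 := lt_min hε one_pos
  let η : ContDiffBump (0 : R2n n) := ⟨min ε 1 / 2, min ε 1, half_pos hδ, half_lt_self hδ⟩
  set r := min ε 1 / 2 with hr
  have hr0 : 0 < r := half_pos hδ
  have hr1 : r ≤ 1 / 2 := by
    have := min_le_right ε 1
    linarith
  have hη : DerivBounded K (fun (_ : ι) (x : R2n n) => (1 + ‖x‖) ^ (2 : ℝ)) (fun _ => η) :=
    .of_hasCompactSupport η.contDiff η.hasCompactSupport K 2
  have hf := derivBounded_sq_norm.add hη
  have hinv := hf.inv (c := r ^ 2 / 4) (by positivity) (fun _ x => by positivity) fun _ x => by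
    have h0 := norm_nonneg x
    rw [Real.rpow_ofNat]
    by_cases hx : ‖x‖ ≤ r
    · have h1 : η x = 1 := η.one_of_mem_closedBall (by simpa using hx)
      rw [h1]
      have : r ^ 2 / 4 * (1 + ‖x‖) ^ 2 ≤ 1 := by
        have h2 : r * (1 + ‖x‖) ≤ 1 / 2 * 2 := mul_le_mul hr1 (by linarith) (by positivity)
          (by positivity)
        have h3 : 0 ≤ r * (1 + ‖x‖) := by positivity
        nlinarith
      have h2 := sq_nonneg ‖x.1‖
      have h3 := sq_nonneg ‖x.2‖
      linarith
    · have h1 : ‖x‖ ^ 2 ≤ ‖x.1‖ ^ 2 + ‖x.2‖ ^ 2 := by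
        rw [Prod.norm_def]
        rcases max_choice ‖x.1‖ ‖x.2‖ with h | h <;> rw [h] <;> nlinarith [sq_nonneg ‖x.1‖, sq_nonneg ‖x.2‖]
      have h2 : r * (1 + ‖x‖) ≤ 2 * ‖x‖ := by nlinarith
      have h3 : 0 ≤ r * (1 + ‖x‖) := by positivity
      have h4 : 0 ≤ η x := η.nonneg
      nlinarith
  have hχ' : DerivBounded K (fun (_ : ι) (x : R2n n) => (1 + ‖x‖) ^ (0 : ℝ))
      (fun _ x => 1 - χc x) := by
    refine .sub ?_ (.of_hasCompactSupport hχ hχcp K 0)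
    simpa using DerivBounded.const (ι := ι) (E := R2n n) (K := K) (1 : ℝ)
  have heq : (fun (_ : ι) => Lcoef χc) = fun (_ : ι) (x : R2n n) =>
      (1 - χc x) • (‖x.1‖ ^ 2 + ‖x.2‖ ^ 2 + η x)⁻¹ := by
    funext _ x
    rw [Lcoef, smul_eq_mul, div_eq_mul_inv]
    by_cases hx : x ∈ Metric.ball (0 : R2n n) (min ε 1)
    · rw [hεχ x (Metric.ball_subset_ball (min_le_left _ _) hx)]
      simp
    · have h1 : η x = 0 := η.zero_of_le_dist (by rw [Metric.mem_ball, not_lt] at hx; exact hx)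
      rw [h1, add_zero]
  rw [heq]
  refine (hχ'.smul hinv).mono_weight (c := 1) (fun _ x => by positivity) fun _ x => ?_
  rw [Real.rpow_zero, one_mul, one_mul, Real.rpow_neg (by positivity)]

theorem DerivBounded.Ltrans (hχ : ContDiff ℝ ∞ χc) (hχcp : HasCompactSupport χc)
    (hχ1 : ∀ᶠ x in 𝓝 (0 : R2n n), χc x = 1) {r : ℝ} {f : ι → R2n n → B}
    (hf : DerivBounded (K + 1) (fun _ x => (1 + ‖x‖) ^ r) f) :
    DerivBounded K (fun _ x => (1 + ‖x‖) ^ (r - 1)) (fun i => Ltrans χc (f i)) := by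
  have hL : DerivBounded (K + 1) (fun (_ : ι) (x : R2n n) => (1 + ‖x‖) ^ (-2 : ℝ))
    (fun _ => Lcoef χc) := derivBounded_Lcoef hχ hχcp hχ1
  have main : ∀ (g : ι → R2n n → ℝ) (v : R2n n),
      DerivBounded (K + 1) (fun _ x => (1 + ‖x‖) ^ (1 : ℝ)) g →
      DerivBounded K (fun _ x => (1 + ‖x‖) ^ (r - 1)) fun i x =>
        (-Complex.I) • _root_.fderiv ℝ (fun y => (Lcoef χc y * g i y) • f i y) x v := by
    intro g v hg
    have h1 := (((hL.bilin_rpow (ContinuousLinearMap.mul ℝ ℝ) hg).bilin_rpow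
      (ContinuousLinearMap.lsmul ℝ ℝ) hf).fderiv_apply v).clm
      (((-Complex.I) • ContinuousLinearMap.id ℂ B).restrictScalars ℝ)
    exact h1.mono_rpow (by linarith)
  refine .sub ?_ (.sum _ fun j _ => .add ?_ ?_)
  · exact ((DerivBounded.of_hasCompactSupport hχ hχcp K (-1)).bilin_rpow
      (ContinuousLinearMap.lsmul ℝ ℝ) (hf.mono_order (Nat.le_succ K))).mono_rpow (by linarith)
  · exact main _ _ (derivBounded_coord_snd j)
  · exact main _ _ (derivBounded_coord_fst j)

theorem DerivBounded.iterate_Ltrans (hχ : ContDiff ℝ ∞ χc) (hχcp : HasCompactSupport χc)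
    (hχ1 : ∀ᶠ x in 𝓝 (0 : R2n n), χc x = 1) (N : ℕ) {r : ℝ} {f : ι → R2n n → B}
    (hf : DerivBounded (K + N) (fun _ x => (1 + ‖x‖) ^ r) f) :
    DerivBounded K (fun _ x => (1 + ‖x‖) ^ (r - N)) (fun i => (_root_.Ltrans χc)^[N] (f i)) := by
  induction N generalizing K with
  | zero => simpa using hf
  | succ N ih =>
    have h1 := (ih (K := K + 1) (hf.mono_order (by omega))).Ltrans hχ hχcp hχ1
    simp only [Function.iterate_succ_apply']
    exact h1.mono_rpow (by push_cast; linarith)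

theorem Ltrans_congr {f g : R2n n → B} {x : R2n n} (hfg : f =ᶠ[𝓝 x] g) :
    Ltrans χc f =ᶠ[𝓝 x] Ltrans χc g := by
  filter_upwards [hfg.eventually_nhds] with y hy
  have h1 : ∀ c : R2n n → ℝ, fderiv ℝ (fun z => c z • f z) y = fderiv ℝ (fun z => c z • g z) y :=
    fun c => Filter.EventuallyEq.fderiv_eq (hy.mono fun z hz => by simp only [hz])
  simp only [Ltrans, pdS, pdXi, h1, hy.self_of_nhds]

theorem iterate_Ltrans_congr (N : ℕ) {f g : R2n n → B} {x : R2n n} (hfg : f =ᶠ[𝓝 x] g) :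
    (Ltrans χc)^[N] f =ᶠ[𝓝 x] (Ltrans χc)^[N] g := by
  induction N with
  | zero => exact hfg
  | succ N ih =>
    simp only [Function.iterate_succ_apply']
    exact Ltrans_congr ih

end TransposedOperator

section OscillatingIntegral

open scoped ContDiff
open MeasureTheory

variable {B : Type} [NormedRing B] [NormedAlgebra ℂ B] {χc : R2n n → ℝ}

/-- The phase `(s,ξ) ↦ e^{is·ξ}`. -/
def oscPhase (x : R2n n) : ℂ := Complex.exp (Complex.I * ((∑ j, x.1 j * x.2 j : ℝ) : ℂ))

theorem norm_oscPhase (x : R2n n) : ‖oscPhase x‖ = 1 := by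
  rw [oscPhase, mul_comm, Complex.norm_exp_ofReal_mul_I]

theorem contDiff_oscPhase : ContDiff ℝ ∞ (oscPhase (n := n)) := by
  unfold oscPhase
  refine (contDiff_const.mul (Complex.ofRealCLM.contDiff.comp (f := fun x : R2n n =>
    ∑ j, x.1 j * x.2 j) ?_)).cexp
  exact ContDiff.sum (s := Finset.univ) fun j _ =>
    ((EuclideanSpace.proj j : Rn n →L[ℝ] ℝ).contDiff.comp contDiff_fst).mul
      ((EuclideanSpace.proj j : Rn n →L[ℝ] ℝ).contDiff.comp contDiff_snd)

theorem fderiv_oscPhase (x v : R2n n) : fderiv ℝ (oscPhase (n := n)) x v =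
    Complex.I * ((∑ j, (v.1 j * x.2 j + x.1 j * v.2 j) : ℝ) : ℂ) * oscPhase x := by
  have h1 : ∀ j, HasFDerivAt (fun x : R2n n => x.1 j)
      ((EuclideanSpace.proj j : Rn n →L[ℝ] ℝ).comp (ContinuousLinearMap.fst ℝ _ _)) x := fun j =>
    ContinuousLinearMap.hasFDerivAt
      ((EuclideanSpace.proj j : Rn n →L[ℝ] ℝ).comp (ContinuousLinearMap.fst ℝ (Rn n) (Rn n)))
  have h2 : ∀ j, HasFDerivAt (fun x : R2n n => x.2 j)
      ((EuclideanSpace.proj j : Rn n →L[ℝ] ℝ).comp (ContinuousLinearMap.snd ℝ _ _)) x := fun j =>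
    ContinuousLinearMap.hasFDerivAt
      ((EuclideanSpace.proj j : Rn n →L[ℝ] ℝ).comp (ContinuousLinearMap.snd ℝ (Rn n) (Rn n)))
  have h3 := HasFDerivAt.fun_sum (u := Finset.univ) fun j _ => (h1 j).fun_mul (h2 j)
  have h4 := ((Complex.ofRealCLM.hasFDerivAt.comp x h3).const_mul Complex.I).cexp
  have h5 : HasFDerivAt (oscPhase (n := n)) _ x := h4
  have h6 : ∀ (j : Fin n) (y : Rn n), (EuclideanSpace.proj j : Rn n →L[ℝ] ℝ) y = y j :=
    fun _ _ => rfl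
  rw [h5.fderiv]
  simp only [oscPhase, Complex.ofReal_sum, _root_.smul_apply, smul_eq_mul,
    ContinuousLinearMap.comp_apply, _root_.sum_apply, _root_.add_apply,
    Complex.ofRealCLM_apply, Function.comp_apply, ContinuousLinearMap.coe_fst',
    ContinuousLinearMap.coe_snd', h6, Complex.ofReal_add, Complex.ofReal_mul]
  rw [mul_comm]
  congr 2
  exact Finset.sum_congr rfl fun j _ => by ring

theorem integrable_oscPhase_smul {g : R2n n → B} (hg : Integrable g) :
    Integrable fun x => oscPhase x • g x :=
  hg.bdd_smul 1 contDiff_oscPhase.continuous.aestronglyMeasurable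
    (ae_of_all _ fun x => (norm_oscPhase x).le)

instance isAddHaarMeasure_volume_R2n : (volume : Measure (R2n n)).IsAddHaarMeasure :=
  Measure.prod.instIsAddHaarMeasure _ _

theorem tendsto_Josc (hχ : ContDiff ℝ ∞ χc) (hχcp : HasCompactSupport χc)
    (hχ1 : ∀ᶠ x in 𝓝 (0 : R2n n), χc x = 1) {r : ℝ} {N : ℕ} (hN : r + 2 * n < N)
    {a : R2n n → B} (ha : DerivBounded N (fun (_ : ℕ) x => (1 + ‖x‖) ^ r) fun _ => a)
    {ψ : ℕ → R2n n → ℝ} (hψ : DerivBounded N (fun _ x => (1 + ‖x‖) ^ (0 : ℝ)) ψ)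
    (hψ1 : ∀ x, ∀ᶠ i in atTop, ∀ᶠ y in 𝓝 x, ψ i y = 1) :
    Tendsto (fun i => Josc χc N fun x => ψ i x • a x) atTop (𝓝 (Josc χc N a)) := by
  have h1 : DerivBounded (0 + N) (fun _ x => (1 + ‖x‖) ^ r) fun i x => ψ i x • a x :=
    ((hψ.bilin_rpow (ContinuousLinearMap.lsmul ℝ ℝ) ha).mono_rpow (by simp)).mono_order (by simp)
  have h2 := h1.iterate_Ltrans hχ hχcp hχ1
  obtain ⟨C, hC⟩ := h2.norm_le
  have hinteg : Integrable fun x : R2n n => (1 + ‖x‖) ^ (r - N) := by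
    have := integrable_one_add_norm (E := R2n n) (μ := volume) (r := N - r) (by
      rw [Module.finrank_prod, finrank_euclideanSpace_fin]
      push_cast
      linarith)
    simpa using this
  refine Tendsto.const_smul ?_ _
  refine tendsto_integral_of_dominated_convergence (fun x => C * (1 + ‖x‖) ^ (r - N))
    (fun i => ?_) (hinteg.const_mul C) (fun i => ae_of_all _ fun x => ?_) (ae_of_all _ fun x => ?_)
  · exact (contDiff_oscPhase.continuous.smul (h2.1 i).continuous).aestronglyMeasurable
  · rw [norm_smul]
    change ‖oscPhase x‖ * _ ≤ _
    rw [norm_oscPhase, one_mul]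
    exact hC i x
  · refine tendsto_const_nhds.congr' ((hψ1 x).mono fun i hi => ?_)
    have h3 : (fun y => ψ i y • a y) =ᶠ[𝓝 x] a := hi.mono fun y hy => by
      simp only [hy, one_smul]
    simp only [(iterate_Ltrans_congr N h3).self_of_nhds]

theorem contDiff_Ltrans (hχ : ContDiff ℝ ∞ χc) (hχcp : HasCompactSupport χc)
    (hχ1 : ∀ᶠ x in 𝓝 (0 : R2n n), χc x = 1) {c : R2n n → B} (hc : ContDiff ℝ ∞ c)
    (hcs : HasCompactSupport c) : ContDiff ℝ ∞ (Ltrans χc c) :=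
  ((DerivBounded.of_hasCompactSupport (ι := Unit) hc hcs (0 + 1) 0).Ltrans hχ hχcp hχ1).1 ()

theorem hasCompactSupport_Ltrans {c : R2n n → B} (hcs : HasCompactSupport c) :
    HasCompactSupport (Ltrans χc c) := by
  refine hcs.mono' (Function.support_subset_iff'.2 fun x hx => ?_)
  have h1 : c =ᶠ[𝓝 x] 0 := notMem_tsupport_iff_eventuallyEq.1 hx
  rw [(Ltrans_congr h1).self_of_nhds]
  simp [Ltrans, pdS, pdXi]

theorem integral_oscPhase_fderiv {g : R2n n → B} (hg : ContDiff ℝ ∞ g)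
    (hgs : HasCompactSupport g) (v : R2n n) :
    ∫ x, oscPhase x • fderiv ℝ g x v =
      -∫ x, oscPhase x • (Complex.I * ((∑ j, (v.1 j * x.2 j + x.1 j * v.2 j) : ℝ) : ℂ)) • g x := by
  have hd : Differentiable ℝ (oscPhase (n := n)) := contDiff_oscPhase.differentiable (by simp)
  rw [integral_smul_fderiv_eq_neg_fderiv_smul_of_integrable]
  · simp only [fderiv_oscPhase, smul_smul, mul_comm]
  · exact (((contDiff_oscPhase.continuous_fderiv (by simp)).clm_apply continuous_const).smul
      hg.continuous).integrable_of_hasCompactSupport hgs.smul_left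
  · exact integrable_oscPhase_smul ((((hg.continuous_fderiv (by simp)).clm_apply
      continuous_const)).integrable_of_hasCompactSupport (hgs.fderiv_apply ℝ v))
  · exact integrable_oscPhase_smul (hg.continuous.integrable_of_hasCompactSupport hgs)
  · exact fun x _ => hd x
  · exact fun x _ => hg.differentiable (by simp) x

theorem integral_oscPhase_Ltrans (hχ : ContDiff ℝ ∞ χc) (hχcp : HasCompactSupport χc)
    (hχ1 : ∀ᶠ x in 𝓝 (0 : R2n n), χc x = 1) {c : R2n n → B} (hc : ContDiff ℝ ∞ c)
    (hcs : HasCompactSupport c) :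
    ∫ x, oscPhase x • Ltrans χc c x = ∫ x, oscPhase x • c x := by
  have hL : ContDiff ℝ ∞ (Lcoef χc) :=
    (derivBounded_Lcoef (ι := Unit) (K := 0) hχ hχcp hχ1).1 ()
  have hp1 : ∀ j, ContDiff ℝ ∞ fun x : R2n n => x.1 j := fun j =>
    (EuclideanSpace.proj j : Rn n →L[ℝ] ℝ).contDiff.comp contDiff_fst
  have hp2 : ∀ j, ContDiff ℝ ∞ fun x : R2n n => x.2 j := fun j =>
    (EuclideanSpace.proj j : Rn n →L[ℝ] ℝ).contDiff.comp contDiff_snd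
  have hinteg : ∀ g : R2n n → B, ContDiff ℝ ∞ g → HasCompactSupport g →
      Integrable fun x => oscPhase x • g x := fun g hg hgs =>
    integrable_oscPhase_smul (hg.continuous.integrable_of_hasCompactSupport hgs)
  have key : ∀ (q : R2n n → ℝ) (v : R2n n), ContDiff ℝ ∞ q →
      Integrable (fun x => oscPhase x • (-Complex.I) • fderiv ℝ (fun y => q y • c y) x v) ∧
      ∫ x, oscPhase x • (-Complex.I) • fderiv ℝ (fun y => q y • c y) x v =
        -∫ x, oscPhase x • ((∑ j, (v.1 j * x.2 j + x.1 j * v.2 j)) * q x) • c x := by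
    intro q v hq
    have hg : ContDiff ℝ ∞ fun y => q y • c y := hq.smul hc
    have hgs : HasCompactSupport fun y => q y • c y := hcs.smul_left
    have h1 : ∀ x, oscPhase x • (-Complex.I) • fderiv ℝ (fun y => q y • c y) x v =
        (-Complex.I) • oscPhase x • fderiv ℝ (fun y => q y • c y) x v := fun x => smul_comm _ _ _
    simp only [h1]
    refine ⟨(hinteg _ ((hg.fderiv_right (m := ∞) (by simp)).clm_apply contDiff_const)
      (hgs.fderiv_apply ℝ v)).smul (-Complex.I), ?_⟩
    rw [integral_smul, integral_oscPhase_fderiv hg hgs, smul_neg, ← integral_smul]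
    congr 2
    funext x
    rw [smul_comm, ← smul_assoc (-Complex.I), smul_eq_mul, ← mul_assoc, neg_mul, Complex.I_mul_I,
      neg_neg, one_mul, mul_smul, Complex.coe_smul]
  have hsingle : ∀ (j : Fin n) (y : Rn n),
      ∑ i, (EuclideanSpace.single j (1 : ℝ) : Rn n) i * y i = y j := fun j y => by simp
  have hsingle' : ∀ (j : Fin n) (y : Rn n),
      ∑ i, y i * (EuclideanSpace.single j (1 : ℝ) : Rn n) i = y j := fun j y => by simp
  have hk1 := fun j => key _ (EuclideanSpace.single j 1, 0) (hL.mul (hp2 j))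
  have hk2 := fun j => key _ (0, EuclideanSpace.single j 1) (hL.mul (hp1 j))
  simp only [PiLp.zero_apply, mul_zero, zero_mul, add_zero, zero_add, hsingle, hsingle'] at hk1 hk2
  have hi : ∀ q : R2n n → ℝ, ContDiff ℝ ∞ q → Integrable fun x => oscPhase x • q x • c x :=
    fun q hq => hinteg _ (hq.smul hc) hcs.smul_left
  have hj1 := fun j => hi _ ((hp2 j).mul (hL.mul (hp2 j)))
  have hj2 := fun j => hi _ ((hp1 j).mul (hL.mul (hp1 j)))
  have hpt : ∀ x : R2n n, oscPhase x • c x = oscPhase x • χc x • c x +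
      ∑ j, (oscPhase x • (x.2 j * (Lcoef χc x * x.2 j)) • c x +
        oscPhase x • (x.1 j * (Lcoef χc x * x.1 j)) • c x) := fun x => by
    simp only [← smul_add, ← Finset.smul_sum, ← add_smul, ← Finset.sum_smul]
    congr 1
    have h1 : χc x + ∑ j, (x.2 j * (Lcoef χc x * x.2 j) + x.1 j * (Lcoef χc x * x.1 j)) = 1 := by
      have h2 : ∑ j, (x.2 j * (Lcoef χc x * x.2 j) + x.1 j * (Lcoef χc x * x.1 j)) =
          Lcoef χc x * (‖x.1‖ ^ 2 + ‖x.2‖ ^ 2) := by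
        rw [EuclideanSpace.real_norm_sq_eq, EuclideanSpace.real_norm_sq_eq, ← Finset.sum_add_distrib,
          Finset.mul_sum]
        exact Finset.sum_congr rfl fun j _ => by ring
      rw [h2, Lcoef]
      by_cases hx : ‖x.1‖ ^ 2 + ‖x.2‖ ^ 2 = 0
      · have h3 : ‖x.1‖ ^ 2 = 0 := by nlinarith [sq_nonneg ‖x.1‖, sq_nonneg ‖x.2‖]
        have h4 : ‖x.2‖ ^ 2 = 0 := by nlinarith [sq_nonneg ‖x.1‖, sq_nonneg ‖x.2‖]
        have h5 : x = 0 := Prod.ext (by simpa using h3) (by simpa using h4)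
        rw [hx, mul_zero, add_zero, h5]
        exact hχ1.self_of_nhds
      · rw [div_mul_cancel₀ _ hx]
        ring
    rw [h1, one_smul]
  simp only [Ltrans, pdS, pdXi, smul_sub, Finset.smul_sum, smul_add, hpt]
  have hi1 : Integrable fun x => ∑ j,
      (oscPhase x • (-Complex.I) • fderiv ℝ (fun y => (Lcoef χc y * y.2 j) • c y) x
        (EuclideanSpace.single j 1, 0) +
      oscPhase x • (-Complex.I) • fderiv ℝ (fun y => (Lcoef χc y * y.1 j) • c y) x
        (0, EuclideanSpace.single j 1)) :=
    integrable_finsetSum Finset.univ fun j _ => (hk1 j).1.fun_add (hk2 j).1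
  have hi2 : Integrable fun x : R2n n => ∑ j,
      (oscPhase x • (x.2 j * (Lcoef χc x * x.2 j)) • c x +
        oscPhase x • (x.1 j * (Lcoef χc x * x.1 j)) • c x) :=
    integrable_finsetSum Finset.univ fun j _ => (hj1 j).fun_add (hj2 j)
  rw [integral_sub (hi _ hχ) hi1, integral_add (hi _ hχ) hi2,
    integral_finsetSum Finset.univ fun j _ => (hk1 j).1.fun_add (hk2 j).1,
    integral_finsetSum Finset.univ fun j _ => (hj1 j).fun_add (hj2 j)]
  simp only [integral_add (hk1 _).1 (hk2 _).1, integral_add (hj1 _) (hj2 _), (hk1 _).2, (hk2 _).2]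
  simp only [← neg_add, Finset.sum_neg_distrib, sub_neg_eq_add]

theorem Josc_eq_Josc_zero (hχ : ContDiff ℝ ∞ χc) (hχcp : HasCompactSupport χc)
    (hχ1 : ∀ᶠ x in 𝓝 (0 : R2n n), χc x = 1) (N : ℕ) {c : R2n n → B} (hc : ContDiff ℝ ∞ c)
    (hcs : HasCompactSupport c) : Josc χc N c = Josc χc 0 c := by
  induction N generalizing c with
  | zero => rfl
  | succ N ih =>
    have h1 : Josc χc (N + 1) c = Josc χc N (Ltrans χc c) := by
      simp only [Josc, Function.iterate_succ_apply]
    rw [h1, ih (contDiff_Ltrans hχ hχcp hχ1 hc hcs) (hasCompactSupport_Ltrans hcs)]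
    exact congrArg (((2 * Real.pi) ^ n)⁻¹ • ·) (integral_oscPhase_Ltrans hχ hχcp hχ1 hc hcs)

end OscillatingIntegral

section Cutoff

open scoped ContDiff
open MeasureTheory

/-- A bump function on `ℝⁿ`, equal to `1` on the unit ball, dilated by the factor `i + 1`. -/
def dilatedBump (i : ℕ) (ξ : Rn n) : ℝ :=
  (⟨1, 2, one_pos, one_lt_two⟩ : ContDiffBump (0 : Rn n)) ((i + 1 : ℝ)⁻¹ • ξ)

theorem contDiff_dilatedBump (i : ℕ) : ContDiff ℝ ∞ (dilatedBump (n := n) i) :=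
  (ContDiffBump.contDiff _).comp (contDiff_const_smul _)

theorem hasCompactSupport_dilatedBump (i : ℕ) : HasCompactSupport (dilatedBump (n := n) i) :=
  (ContDiffBump.hasCompactSupport _).comp_smul (by positivity)

theorem norm_dilatedBump_le (i : ℕ) (ξ : Rn n) : ‖dilatedBump i ξ‖ ≤ 1 := by
  rw [dilatedBump, Real.norm_of_nonneg (ContDiffBump.nonneg _)]
  exact ContDiffBump.le_one _

theorem eventually_dilatedBump_eq_one (ξ : Rn n) :
    ∀ᶠ i in atTop, ∀ᶠ y in 𝓝 ξ, dilatedBump i y = 1 := by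
  obtain ⟨M, hM⟩ := exists_nat_gt ‖ξ‖
  filter_upwards [eventually_ge_atTop M] with i hi
  have h1 : ∀ᶠ y in 𝓝 ξ, ‖y‖ < M := continuous_norm.continuousAt.eventually_lt continuousAt_const hM
  filter_upwards [h1] with y hy
  refine ContDiffBump.one_of_mem_closedBall _ ?_
  have h2 : (M : ℝ) ≤ i := by exact_mod_cast hi
  rw [mem_closedBall_zero_iff, norm_smul, norm_inv, Real.norm_of_nonneg (by positivity)]
  change _ ≤ (1 : ℝ)
  rw [inv_mul_le_one₀ (by positivity)]
  linarith

theorem derivBounded_dilatedBump_comp (K : ℕ) (T : R2n n →L[ℝ] Rn n) (hT : ‖T‖ ≤ 1) :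
    DerivBounded K (fun (_ : ℕ) (x : R2n n) => (1 + ‖x‖) ^ (0 : ℝ))
      (fun i x => dilatedBump i (T x)) := by
  have h1 := (DerivBounded.of_hasCompactSupport (ι := ℕ)
    (ContDiffBump.contDiff (⟨1, 2, one_pos, one_lt_two⟩ : ContDiffBump (0 : Rn n)))
    (ContDiffBump.hasCompactSupport _) K 0).comp_clm (fun i : ℕ => (i + 1 : ℝ)⁻¹ • T) fun i => by
      rw [norm_smul, norm_inv, Real.norm_of_nonneg (by positivity)]
      exact mul_le_one₀ (inv_le_one_of_one_le₀ (by linarith [i.cast_nonneg (α := ℝ)]))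
        (norm_nonneg _) hT
  exact h1.mono_weight (c := 1) (fun _ _ => by simp) (fun _ _ => by simp)

end Cutoff

section OscillatoryTransform

open scoped ContDiff FourierTransform
open MeasureTheory

variable {B : Type} [NormedRing B] [NormedAlgebra ℂ B]

/-- The transform `G(s) = ∫ e^{is·ξ} g(ξ) dξ`. -/
def oscTransform (g : Rn n → B) (s : Rn n) : B := ∫ ξ, oscPhase (s, ξ) • g ξ

theorem oscTransform_eq_fourier (g : Rn n → B) :
    oscTransform g = fun s => 𝓕 g ((-(2 * π)⁻¹ : ℝ) • s) := by
  funext s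
  rw [Real.fourier_eq', oscTransform]
  refine integral_congr_ae (ae_of_all _ fun ξ => ?_)
  have h1 : -2 * π * inner ℝ ξ ((-(2 * π)⁻¹ : ℝ) • s) = ∑ j, s j * ξ j := by
    rw [inner_smul_right, PiLp.inner_apply]
    have : (∑ j, inner ℝ (ξ j) (s j)) = ∑ j, s j * ξ j := Finset.sum_congr rfl fun j _ => by simp
    rw [this]
    field_simp
  simp only [oscPhase]
  rw [h1, mul_comm]

theorem integrable_oscTransform {g : Rn n → B} (hg : ContDiff ℝ ∞ g) (hgs : HasCompactSupport g) :
    Integrable (oscTransform g) := by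
  rw [oscTransform_eq_fourier]
  have h1 := SchwartzMap.integrable (μ := volume) (𝓕 (hgs.toSchwartzMap hg))
  rw [SchwartzMap.fourier_coe] at h1
  exact h1.comp_smul (by simp [Real.pi_ne_zero])

theorem integral_oscPhase_oscTransform [CompleteSpace B] {g : Rn n → B} (hg : ContDiff ℝ ∞ g)
    (hgs : HasCompactSupport g) (ξ : Rn n) :
    ∫ s, oscPhase (-s, ξ) • oscTransform g s = ((2 * π) ^ n : ℝ) • g ξ := by
  have hg1 : Integrable g := hg.continuous.integrable_of_hasCompactSupport hgs
  have h1 := SchwartzMap.integrable (μ := volume) (𝓕 (hgs.toSchwartzMap hg))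
  rw [SchwartzMap.fourier_coe] at h1
  have h2 := congrFun (Continuous.fourierInv_fourier_eq hg.continuous hg1 h1) ξ
  rw [Real.fourierInv_eq'] at h2
  have h3 := Measure.integral_comp_smul (volume : Measure (Rn n))
    (fun w => Complex.exp (↑(2 * π * inner ℝ w ξ) * Complex.I) • 𝓕 g w) (-(2 * π)⁻¹)
  rw [h2, finrank_euclideanSpace_fin] at h3
  have h4 : |((-(2 * π)⁻¹) ^ n)⁻¹| = (2 * π) ^ n := by
    rw [abs_inv, abs_pow, abs_neg, abs_inv, abs_of_pos (by positivity), inv_pow, inv_inv]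
  rw [h4] at h3
  rw [← h3]
  refine integral_congr_ae (ae_of_all _ fun s => ?_)
  simp only [oscTransform_eq_fourier, oscPhase]
  have h5 : 2 * π * inner ℝ ((-(2 * π)⁻¹ : ℝ) • s) ξ = ∑ j, (-s) j * ξ j := by
    rw [inner_smul_left, PiLp.inner_apply]
    have : (∑ j, inner ℝ (s j) (ξ j)) = ∑ j, s j * ξ j :=
      Finset.sum_congr rfl fun j _ => by simp [mul_comm]
    rw [this]
    simp only [PiLp.neg_apply, neg_mul, Finset.sum_neg_distrib]
    simp
    field_simp
  rw [h5, mul_comm]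

theorem finite_zEmb_mem_of_hasCompactSupport {g : Rn n → B} (hgs : HasCompactSupport g) :
    ∃ S : Finset (Fin n → ℤ), ∀ k ∉ S, g (zEmb k) = 0 := by
  obtain ⟨R, hR⟩ := hgs.isBounded.exists_norm_le
  refine ⟨Finset.Icc (fun _ => -⌈R⌉) (fun _ => ⌈R⌉), fun k hk => ?_⟩
  by_contra hne
  refine hk (Finset.mem_Icc.2 ?_)
  have h1 := hR _ (subset_tsupport g hne)
  have h2 : ∀ j, |(k j : ℝ)| ≤ ⌈R⌉ := fun j =>
    ((PiLp.norm_apply_le (zEmb k) j).trans h1).trans (Int.le_ceil R)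
  refine ⟨fun j => ?_, fun j => ?_⟩
  · have := (abs_le.1 (h2 j)).1
    exact_mod_cast this
  · have := (abs_le.1 (h2 j)).2
    exact_mod_cast this

end OscillatoryTransform

section Quantization

open scoped ContDiff
open MeasureTheory

theorem δpow_zero (αa : Rn n → (A ≃⋆ₐ[ℂ] A)) (u : A) : δpow αa 0 u = u := by
  simp only [δpow, Pi.zero_apply, Function.iterate_zero, List.ofFn_eq_map]
  induction List.finRange n with
  | nil => rfl
  | cons j L ih => exact ih

namespace IsNCTorus

variable {θ : Matrix (Fin n) (Fin n) ℝ} {Uk : (Fin n → ℤ) → A} {τ : A →L[ℂ] ℂ}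
  {αa : Rn n → (A ≃⋆ₐ[ℂ] A)} (h : IsNCTorus θ Uk τ αa)

include h

theorem continuous_orbit (u : A) : Continuous fun s => αa s u := by
  refine continuous_of_uniform_approx_of_continuous fun V hV => ?_
  obtain ⟨ε, hε, hεV⟩ := Metric.mem_uniformity_dist.1 hV
  obtain ⟨v, hv, hvu⟩ := Metric.dense_iff.1 h.dense u ε hε
  refine ⟨fun s => αa s v, ?_, fun s => hεV ?_⟩
  · have hv' : v ∈ Submodule.span ℂ (Set.range Uk) := hvu
    clear hv hvu
    induction hv' using Submodule.span_induction with
    | mem x hx =>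
      obtain ⟨k, rfl⟩ := hx
      exact (h.mem_smoothSet.1 (h.U_mem k)).continuous
    | zero => simpa only [map_zero] using continuous_const
    | add x y _ _ hx hy => simpa only [map_add] using hx.fun_add hy
    | smul c x _ hx => simpa only [map_smul] using hx.fun_const_smul c
  · rw [dist_eq_norm, ← map_sub, h.act_norm, ← dist_eq_norm, dist_comm]
    exact hv

theorem integrable_mul_orbit {G : Rn n → A} (hG : Integrable G) (u : A) :
    Integrable fun s => G s * αa (-s) u := by
  refine (hG.norm.mul_const ‖u‖).mono' (hG.aestronglyMeasurable.mul
    ((h.continuous_orbit u).comp continuous_neg).aestronglyMeasurable) (ae_of_all _ fun s => ?_)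
  exact (norm_mul_le _ _).trans_eq (by rw [h.act_norm])

theorem integral_oscTransform_mul_orbit {g : Rn n → A} (hg : ContDiff ℝ ∞ g)
    (hgs : HasCompactSupport g) {S : Finset (Fin n → ℤ)} (hS : ∀ k ∉ S, g (zEmb k) = 0) (u : A) :
    ((2 * π) ^ n : ℝ)⁻¹ • ∫ s, oscTransform g s * αa (-s) u =
      ∑ k ∈ S, fcoef Uk τ k u • (g (zEmb k) * Uk k) := by
  have hG := integrable_oscTransform hg hgs
  let I : A →L[ℂ] A := LinearMap.mkContinuous
    { toFun := fun u => ∫ s, oscTransform g s * αa (-s) u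
      map_add' := fun u v => by
        simp only [map_add, mul_add]
        exact integral_add (h.integrable_mul_orbit hG u) (h.integrable_mul_orbit hG v)
      map_smul' := fun c u => by
        simp only [map_smul, mul_smul_comm, RingHom.id_apply]
        exact integral_smul c _ } (∫ s, ‖oscTransform g s‖) fun u => by
      refine (norm_integral_le_integral_norm _).trans ?_
      rw [← integral_mul_const]
      refine integral_mono (h.integrable_mul_orbit hG u).norm (hG.norm.mul_const _) fun s => ?_
      exact (norm_mul_le _ _).trans_eq (by rw [h.act_norm])
  have hI : ∀ l, I (Uk l) = ((2 * π) ^ n : ℝ) • (g (zEmb l) * Uk l) := by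
    intro l
    change ∫ s, oscTransform g s * αa (-s) (Uk l) = _
    rw [← smul_mul_assoc, ← integral_oscPhase_oscTransform hg hgs]
    have h1 : Integrable fun s => oscPhase (-s, zEmb l) • oscTransform g s :=
      hG.bdd_smul 1 (contDiff_oscPhase.continuous.comp
        (continuous_neg.prodMk continuous_const)).aestronglyMeasurable
        (ae_of_all _ fun s => (norm_oscPhase _).le)
    rw [← integral_mul_const_of_integrable h1]
    refine integral_congr_ae (ae_of_all _ fun s => ?_)
    simp only [h.act_U, mul_smul_comm, smul_mul_assoc]
    rfl
  have key : (((2 * π) ^ n : ℝ)⁻¹ • I : A →L[ℂ] A) = ∑ k ∈ S,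
      (fcoef Uk τ k).smulRight (g (zEmb k) * Uk k) := by
    refine ContinuousLinearMap.ext_on h.dense ?_
    rintro _ ⟨l, rfl⟩
    rw [_root_.smul_apply, hI, smul_smul, inv_mul_cancel₀ (by positivity), one_smul,
      _root_.sum_apply]
    simp only [ContinuousLinearMap.smulRight_apply, h.fcoef_U, ite_smul, one_smul, zero_smul]
    rw [Finset.sum_ite_eq]
    split_ifs with hl
    · rfl
    · rw [hS l hl, zero_mul]
  have := congrArg (fun T : A →L[ℂ] A => T u) key
  simpa [I] using this

theorem contDiff_symbol {m : ℝ} {ρ : Rn n → A} (hρ : IsSymbol αa m ρ) : ContDiff ℝ ∞ ρ :=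
  contDiff_infty.2 fun N => by simpa only [δpow_zero] using hρ.2.1 0 N

theorem derivBounded_amplitude {ι : Type*} {m : ℝ} {ρ : Rn n → A} (hρ : IsSymbol αa m ρ) {u : A}
    (hu : u ∈ SmoothSet αa) (K : ℕ) :
    DerivBounded K (fun (_ : ι) (x : R2n n) => (1 + ‖x‖) ^ max m 0)
      fun _ x => ρ x.2 * αa (-x.1) u := by
  have hρs := h.contDiff_symbol hρ
  have h1 : DerivBounded K (fun (_ : ι) (ξ : Rn n) => (1 + ‖ξ‖) ^ max m 0) fun _ => ρ := by
    refine .of_pd (fun _ _ => by positivity) (fun _ => hρs) (fun l => ?_) K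
    obtain ⟨b, hb⟩ := exists_foldr_pd_eq_pdPow (B := A) l
    obtain ⟨C, hC0, hC⟩ := hρ.2.2 0 b
    refine ⟨C, fun _ ξ => ?_⟩
    have h2 := hC ξ
    rw [δpow_zero, ← hb _ hρs] at h2
    refine h2.trans (mul_le_mul_of_nonneg_left ?_ hC0.le)
    refine Real.rpow_le_rpow_of_exponent_le (by linarith [norm_nonneg ξ]) ?_
    exact (sub_le_self _ (Nat.cast_nonneg _)).trans (le_max_left _ _)
  have h2 : DerivBounded K (fun (_ : ι) (_ : Rn n) => (1 : ℝ)) fun _ s => αa s u :=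
    h.derivBounded_orbit (fun _ => zero_le_one) (fun _ => hu)
      (fun l => ⟨‖l.foldr (δd αa) u‖, fun _ => by rw [mul_one]⟩) K
  have h3 : DerivBounded K (fun (_ : ι) (x : R2n n) => (1 + ‖x‖) ^ max m 0) fun _ x => ρ x.2 := by
    refine (h1.comp_clm (fun _ => ContinuousLinearMap.snd ℝ (Rn n) (Rn n))
      fun _ => ContinuousLinearMap.norm_snd_le ℝ _ _).mono_weight (c := 1)
      (fun _ x => by positivity) fun _ x => ?_
    rw [one_mul]
    exact Real.rpow_le_rpow (by positivity) (by gcongr; exact norm_snd_le x) (le_max_right _ _)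
  have h4 : DerivBounded K (fun (_ : ι) (x : R2n n) => (1 + ‖x‖) ^ (0 : ℝ))
      fun _ x => αa (-x.1) u :=
    (h2.comp_clm (fun _ => -ContinuousLinearMap.fst ℝ (Rn n) (Rn n)) fun _ => by
      rw [norm_neg]
      exact ContinuousLinearMap.norm_fst_le ℝ _ _).mono_weight (c := 1)
      (fun _ _ => zero_le_one) fun _ x => by simp
  exact (h3.bilin_rpow (ContinuousLinearMap.mul ℝ A) h4).mono_rpow (by simp)

theorem Josc_zero_cutoff {χc : R2n n → ℝ} {φ : Rn n → ℝ} (hφ : Continuous φ)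
    (hφs : HasCompactSupport φ) {g : Rn n → A} (hg : Continuous g) (hgs : HasCompactSupport g)
    (u : A) :
    Josc χc 0 (fun x => φ x.1 • (g x.2 * αa (-x.1) u)) =
      ((2 * π) ^ n : ℝ)⁻¹ • ∫ s, φ s • (oscTransform g s * αa (-s) u) := by
  have hc : Continuous fun x : R2n n => φ x.1 • (g x.2 * αa (-x.1) u) :=
    (hφ.comp continuous_fst).smul ((hg.comp continuous_snd).mul
      ((h.continuous_orbit u).comp continuous_fst.neg))
  have hs : HasCompactSupport fun x : R2n n => φ x.1 • (g x.2 * αa (-x.1) u) := by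
    refine HasCompactSupport.of_support_subset_isCompact (hφs.isCompact.prod hgs.isCompact) ?_
    intro x hx
    refine ⟨subset_tsupport φ fun h0 => hx ?_, subset_tsupport g fun h0 => hx ?_⟩
    · simp [h0]
    · simp [h0]
  have hi := integrable_oscPhase_smul (hc.integrable_of_hasCompactSupport hs)
  refine congrArg (((2 * π) ^ n : ℝ)⁻¹ • ·) ?_
  refine (integral_prod _ hi).trans (integral_congr_ae (ae_of_all _ fun s => ?_))
  have hgi : Integrable fun ξ => oscPhase (s, ξ) • g ξ :=
    (hg.integrable_of_hasCompactSupport hgs).bdd_smul 1 (contDiff_oscPhase.continuous.comp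
        (Continuous.prodMk_right s)).aestronglyMeasurable
        (ae_of_all _ fun s => (norm_oscPhase _).le)
  simp only [oscTransform]
  rw [← integral_mul_const_of_integrable hgi, ← integral_smul]
  refine integral_congr_ae (ae_of_all _ fun ξ => ?_)
  simp only [smul_mul_assoc]
  exact smul_comm _ _ _

theorem Josc_hasCompactSupport {χc : R2n n → ℝ} (hχ : ContDiff ℝ ∞ χc)
    (hχcp : HasCompactSupport χc) (hχ1 : ∀ᶠ x in 𝓝 (0 : R2n n), χc x = 1) {r : ℝ} {N : ℕ}
    (hN : r + 2 * n < N) {g : Rn n → A} (hg : ContDiff ℝ ∞ g) (hgs : HasCompactSupport g) {u : A}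
    (ha : DerivBounded N (fun (_ : ℕ) (x : R2n n) => (1 + ‖x‖) ^ r)
      fun _ x => g x.2 * αa (-x.1) u)
    {S : Finset (Fin n → ℤ)} (hS : ∀ k ∉ S, g (zEmb k) = 0) :
    Josc χc N (fun x => g x.2 * αa (-x.1) u) =
      ∑ k ∈ S, fcoef Uk τ k u • (g (zEmb k) * Uk k) := by
  rw [← h.integral_oscTransform_mul_orbit hg hgs hS u]
  have h1 := tendsto_Josc hχ hχcp hχ1 hN ha
    (derivBounded_dilatedBump_comp N (ContinuousLinearMap.fst ℝ (Rn n) (Rn n))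
      (ContinuousLinearMap.norm_fst_le ℝ _ _))
    fun x => (eventually_dilatedBump_eq_one x.1).mono fun i hi =>
      continuous_fst.continuousAt.eventually hi
  refine tendsto_nhds_unique h1 ?_
  have h2 : ∀ i : ℕ, Josc χc N (fun x => dilatedBump i x.1 • (g x.2 * αa (-x.1) u)) =
      ((2 * π) ^ n : ℝ)⁻¹ • ∫ s, dilatedBump i s • (oscTransform g s * αa (-s) u) := fun i => by
    have hφ := hasCompactSupport_dilatedBump (n := n) i
    have hs : HasCompactSupport fun x : R2n n => dilatedBump i x.1 • (g x.2 * αa (-x.1) u) := by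
      refine HasCompactSupport.of_support_subset_isCompact (hφ.isCompact.prod hgs.isCompact) ?_
      intro x hx
      refine ⟨subset_tsupport (dilatedBump i) fun h0 => hx ?_, subset_tsupport g fun h0 => hx ?_⟩
      · simp [h0]
      · simp [h0]
    have hsm : ContDiff ℝ ∞ fun x : R2n n => dilatedBump i x.1 • (g x.2 * αa (-x.1) u) :=
      ((contDiff_dilatedBump i).comp contDiff_fst).smul (ha.1 0)
    rw [Josc_eq_Josc_zero hχ hχcp hχ1 N hsm hs,
      h.Josc_zero_cutoff (contDiff_dilatedBump i).continuous hφ hg.continuous hgs]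
  have hG := h.integrable_mul_orbit (integrable_oscTransform hg hgs) u
  refine Tendsto.congr (fun i => (h2 i).symm) (Tendsto.const_smul ?_ _)
  refine tendsto_integral_of_dominated_convergence (fun s => ‖oscTransform g s * αa (-s) u‖)
    (fun i => ?_) hG.norm (fun i => ae_of_all _ fun s => ?_) (ae_of_all _ fun s => ?_)
  · exact (contDiff_dilatedBump i).continuous.aestronglyMeasurable.smul hG.aestronglyMeasurable
  · rw [norm_smul]
    exact mul_le_of_le_one_left (norm_nonneg _) (norm_dilatedBump_le i s)
  · refine tendsto_const_nhds.congr' ((eventually_dilatedBump_eq_one s).mono fun i hi => ?_)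
    simp only [hi.self_of_nhds, one_smul]

theorem hasSum_Josc {χc : R2n n → ℝ} (hχ : ContDiff ℝ ∞ χc)
    (hχcp : HasCompactSupport χc) (hχ1 : ∀ᶠ x in 𝓝 (0 : R2n n), χc x = 1) {m : ℝ} {ρ : Rn n → A}
    (hρ : IsSymbol αa m ρ) {N : ℕ} (hN : max m 0 + 2 * n < N) {u : A} (hu : u ∈ SmoothSet αa) :
    HasSum (fun k => fcoef Uk τ k u • (ρ (zEmb k) * Uk k))
      (Josc χc N fun x => ρ x.2 * αa (-x.1) u) := by
  have hsum : Summable fun k => ‖fcoef Uk τ k u • (ρ (zEmb k) * Uk k)‖ :=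
    h.summable_foldr_δd_fcoef_smul (h.polyGrowth_mul_U (h.polyGrowth_symbol hρ)) hu []
  have ha : DerivBounded N (fun (_ : ℕ) (x : R2n n) => (1 + ‖x‖) ^ max m 0)
      fun _ x => ρ x.2 * αa (-x.1) u := h.derivBounded_amplitude hρ hu N
  have hψ := derivBounded_dilatedBump_comp N (ContinuousLinearMap.snd ℝ (Rn n) (Rn n))
    (ContinuousLinearMap.norm_snd_le ℝ _ _)
  have h1 := tendsto_Josc hχ hχcp hχ1 hN ha hψ
    fun x => (eventually_dilatedBump_eq_one x.2).mono fun i hi =>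
      continuous_snd.continuousAt.eventually hi
  have h2 : ∀ i : ℕ, Josc χc N (fun x => dilatedBump i x.2 • (ρ x.2 * αa (-x.1) u)) =
      ∑' k, dilatedBump i (zEmb k) • fcoef Uk τ k u • (ρ (zEmb k) * Uk k) := fun i => by
    have hgs : HasCompactSupport fun ξ => dilatedBump i ξ • ρ ξ :=
      (hasCompactSupport_dilatedBump i).smul_right
    have hg : ContDiff ℝ ∞ fun ξ => dilatedBump i ξ • ρ ξ :=
      (contDiff_dilatedBump i).smul (h.contDiff_symbol hρ)
    obtain ⟨S, hS⟩ := finite_zEmb_mem_of_hasCompactSupport hgs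
    have hai : DerivBounded N (fun (_ : ℕ) (x : R2n n) => (1 + ‖x‖) ^ max m 0)
        fun _ x => (dilatedBump i x.2 • ρ x.2) * αa (-x.1) u := by
      have h3 := (hψ.bilin_rpow (ContinuousLinearMap.lsmul ℝ ℝ) ha).mono_rpow (s := max m 0)
        (by simp)
      simp only [smul_mul_assoc]
      exact ⟨fun _ => h3.1 i, h3.2.imp fun C hC _ x j hj => hC i x j hj⟩
    have h4 := h.Josc_hasCompactSupport hχ hχcp hχ1 hN hg hgs hai hS
    simp only [smul_mul_assoc] at h4
    rw [h4, tsum_eq_sum (s := S) fun k hk => ?_]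
    · exact Finset.sum_congr rfl fun k _ => smul_comm _ _ _
    · rw [smul_comm, ← smul_mul_assoc, hS k hk, zero_mul, smul_zero]
  have h5 : Tendsto (fun i : ℕ =>
      ∑' k, dilatedBump i (zEmb k) • fcoef Uk τ k u • (ρ (zEmb k) * Uk k)) atTop
      (𝓝 (∑' k, fcoef Uk τ k u • (ρ (zEmb k) * Uk k))) := by
    refine tendsto_tsum_of_dominated_convergence hsum (fun k => ?_)
      (Eventually.of_forall fun i k => ?_)
    · refine tendsto_const_nhds.congr'
        ((eventually_dilatedBump_eq_one (zEmb k)).mono fun i hi => ?_)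
      simp only [hi.self_of_nhds, one_smul]
    · rw [norm_smul]
      exact mul_le_of_le_one_left (norm_nonneg _) (norm_dilatedBump_le i _)
  rw [tendsto_nhds_unique h1 (h5.congr fun i => (h2 i).symm)]
  exact hsum.of_norm.hasSum

end IsNCTorus

end Quantization

/-- for `ρ ∈ 𝕊^m(ℝⁿ;𝒜_θ)`, the pseudodifferential operator
`P_ρ u = J(ρ(ξ)α_{−s}(u))` satisfies `P_ρ(U^k) = ρ(k)U^k` for all `k ∈ ℤⁿ`, and for every
`u ∈ 𝒜_θ` with Fourier series `u = Σ u_k U^k` (`u_k = τ(u(U^k)*)`) one has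
`P_ρ u = Σ u_k ρ(k) U^k`, the series converging in `𝒜_θ`. -/
theorem statement_16
    {n : ℕ} (hn : 2 ≤ n)
    (θ : Matrix (Fin n) (Fin n) ℝ) (hθ : ∀ p q, θ q p = - θ p q)
    {A : Type} [NormedRing A] [StarRing A] [CStarRing A] [NormedAlgebra ℂ A]
    [StarModule ℂ A] [CompleteSpace A]
    (Uk : (Fin n → ℤ) → A)
    (hU0 : Uk 0 = 1)
    (hUu : ∀ k, Uk k ∈ unitary A)
    (hUmul : ∀ k l, Uk k * Uk l =
      Complex.exp ((-2 : ℂ) * (Real.pi : ℂ) * Complex.I * (cPhase θ k l : ℂ)) • Uk (k + l))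
    (hdense : Dense (↑(Submodule.span ℂ (Set.range Uk)) : Set A))
    (τ : A →L[ℂ] ℂ)
    (hτU : ∀ k, τ (Uk k) = if k = 0 then 1 else 0)
    (αa : Rn n → (A ≃⋆ₐ[ℂ] A))
    (hαadd : ∀ s t (u : A), αa (s + t) u = αa s (αa t u))
    (hα0 : ∀ u : A, αa 0 u = u)
    (hαiso : ∀ s (u : A), ‖αa s u‖ = ‖u‖)
    (hαU : ∀ s k, αa s (Uk k) =
      Complex.exp (Complex.I * ((∑ j, s j * (k j : ℝ) : ℝ) : ℂ)) • Uk k)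
    (χc : R2n n → ℝ)
    (hχsm : ∀ N : ℕ, ContDiff ℝ N χc)
    (hχcp : HasCompactSupport χc)
    (hχ1 : ∀ᶠ x in nhds (0 : R2n n), χc x = 1)
    (m : ℝ) (ρ : Rn n → A) (hρ : IsSymbol αa m ρ) :
    -- `P_ρ(U^k) = ρ(k) U^k` for every `k ∈ ℤⁿ`
    (∀ k : Fin n → ℤ,
      Josc χc (Nfor n (max m 0))
          (fun x : R2n n => ρ x.2 * αa (-x.1) (Uk k)) =
        ρ (zEmb k) * Uk k) ∧
    -- `P_ρ u = Σ_k u_k ρ(k) U^k`, with convergence in `𝒜_θ` (i.e. in every seminorm)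
    (∀ u ∈ SmoothSet αa,
      HasSum (fun k : Fin n → ℤ => τ (u * star (Uk k)) • (ρ (zEmb k) * Uk k))
        (Josc χc (Nfor n (max m 0)) (fun x : R2n n => ρ x.2 * αa (-x.1) u)) ∧
      ∀ b : Fin n → ℕ,
        HasSum
          (fun k : Fin n → ℤ => δpow αa b (τ (u * star (Uk k)) • (ρ (zEmb k) * Uk k)))
          (δpow αa b
            (Josc χc (Nfor n (max m 0)) (fun x : R2n n => ρ x.2 * αa (-x.1) u)))) := by
  have hχ : ContDiff ℝ ((⊤ : ℕ∞) : WithTop ℕ∞) χc := contDiff_infty.2 hχsm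
  have h : IsNCTorus θ Uk τ αa := ⟨hU0, hUu, hUmul, hdense, hτU, hαadd, hα0, hαiso, hαU⟩
  have hN : max m 0 + 2 * n < (Nfor n (max m 0) : ℝ) := by
    have := Nat.le_ceil (max m 0)
    rw [Nfor]
    push_cast
    linarith
  have hmain := fun u hu => h.hasSum_Josc hχ hχcp hχ1 hρ hN (u := u) hu
  refine ⟨fun k => ?_, fun u hu => ⟨hmain u hu, fun b => ?_⟩⟩
  · refine (hmain (Uk k) (h.U_mem k)).unique ?_
    have h1 := hasSum_single (f := fun l => fcoef Uk τ l (Uk k) • (ρ (zEmb l) * Uk l)) k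
      fun l hl => by rw [h.fcoef_U, if_neg hl.symm, zero_smul]
    simpa only [h.fcoef_U, if_true, one_smul] using h1
  · obtain ⟨l, hl⟩ := exists_compList_eq_foldr (δd αa) b
    have hx := h.polyGrowth_mul_U (h.polyGrowth_symbol hρ)
    have h1 := h.hasSum_foldr_δd (fun k => h.smul_mem (fcoef Uk τ k u) (hx.1 k))
      (fun l => h.summable_foldr_δd_fcoef_smul hx hu l) (hmain u hu) l
    simp only [← hl] at h1
    exact h1
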